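/- Let δ ≥ 1, let N be an admissible norm, and let H_p, H_q be proper, geodesically complete, δ-hyperbolic, Busemann spaces. Then there exists κ ≥ 0, depending only on δ and N, such that every geodesic line α : ℝ → H_p⋈H_q of (H_p⋈H_q, d_{H,N}) satisfies at least one of: (1) α is an H_p-type geodesic at scale κ; (2) α is an H_q-type geodesic at scale κ. -/

import Mathlib

open Set Filter
open scoped ENNReal NNReal

noncomputable section

namespace HP

variable {H : Type*} [MetricSpace H]

/-- `γ` restricted to `I` is an arclength-parametrised (isometric) geodesic. -/
def IsGeodesicOn (γ : ℝ → H) (I : Set ℝ) : Prop :=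
  ∀ s ∈ I, ∀ t ∈ I, dist (γ s) (γ t) = |s - t|

/-- A geodesic line of `H`. -/
def IsGeodesicLine (γ : ℝ → H) : Prop := IsGeodesicOn γ Set.univ

/-- A geodesic ray of `H`, parametrised on `[0,∞)`. -/
def IsGeodesicRay (γ : ℝ → H) : Prop := IsGeodesicOn γ (Set.Ici 0)

/-- A geodesic ray starting at `w`. -/
def IsRayFrom (w : H) (γ : ℝ → H) : Prop := IsGeodesicRay γ ∧ γ 0 = w

/-- A geodesic segment from `x` to `y`, parametrised on `[0, dist x y]`. -/
def IsGeodSegment (γ : ℝ → H) (x y : H) : Prop :=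
  IsGeodesicOn γ (Set.Icc 0 (dist x y)) ∧ γ 0 = x ∧ γ (dist x y) = y

/-- The traces on `[0,∞)` of two rays are at finite Hausdorff distance. -/
def FinHausRays (γ₁ γ₂ : ℝ → H) : Prop :=
  ∃ C : ℝ, (∀ s : ℝ, 0 ≤ s → ∃ t : ℝ, 0 ≤ t ∧ dist (γ₁ s) (γ₂ t) ≤ C) ∧
           (∀ t : ℝ, 0 ≤ t → ∃ s : ℝ, 0 ≤ s ∧ dist (γ₁ s) (γ₂ t) ≤ C)

/-- A geodesic metric space: any two points are joined by a geodesic segment. -/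
def GeodesicSpace (H : Type*) [MetricSpace H] : Prop :=
  ∀ x y : H, ∃ γ : ℝ → H, IsGeodSegment γ x y

/-- `δ`-hyperbolicity: geodesic space all of whose geodesic triangles are `δ`-slim,
i.e. each side is contained in the `δ`-neighbourhood of the union of the other two. -/
def DeltaHyperbolic (H : Type*) [MetricSpace H] (δ : ℝ) : Prop :=
  GeodesicSpace H ∧
  ∀ x y z : H, ∀ γ₁ γ₂ γ₃ : ℝ → H,
    IsGeodSegment γ₁ x y → IsGeodSegment γ₂ y z → IsGeodSegment γ₃ z x →
    ∀ s ∈ Set.Icc (0:ℝ) (dist x y),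
      ∃ u ∈ γ₂ '' Set.Icc (0:ℝ) (dist y z) ∪ γ₃ '' Set.Icc (0:ℝ) (dist z x),
        dist (γ₁ s) u ≤ δ

/-- A Busemann space: geodesic, and the distance between any two
arclength-parametrised geodesics is a convex function. -/
def BusemannSpace (H : Type*) [MetricSpace H] : Prop :=
  GeodesicSpace H ∧
  ∀ (a b a' b' : ℝ) (γ γ' : ℝ → H),
    IsGeodesicOn γ (Set.Icc a b) → IsGeodesicOn γ' (Set.Icc a' b') →
    ConvexOn ℝ (Set.Icc a b ×ˢ Set.Icc a' b')
      (fun p : ℝ × ℝ => dist (γ p.1) (γ' p.2))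

/-- Geodesic completeness: every geodesic segment extends to a geodesic line. -/
def GeodesicallyComplete (H : Type*) [MetricSpace H] : Prop :=
  ∀ (a b : ℝ) (γ : ℝ → H), a ≤ b → IsGeodesicOn γ (Set.Icc a b) →
    ∃ γ' : ℝ → H, IsGeodesicLine γ' ∧ ∀ t ∈ Set.Icc a b, γ' t = γ t

/-- The Busemann function with respect to the boundary point represented by the
geodesic ray `aRep` and the base point `w`. -/
def busemann (w : H) (aRep : ℝ → H) (x : H) : ℝ :=
  sSup { b : ℝ | ∃ k : ℝ → H, IsRayFrom w k ∧ FinHausRays aRep k ∧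
    b = Filter.limsup (fun t => dist x (k t) - t) Filter.atTop }

/-- The height function: minus the Busemann function. -/
def height (w : H) (aRep : ℝ → H) (x : H) : ℝ := - busemann w aRep x

/-- A vertical geodesic (forward oriented): a geodesic line whose height tends to `+∞`. -/
def IsVerticalGeodesic (w : H) (aRep : ℝ → H) (V : ℝ → H) : Prop :=
  IsGeodesicLine V ∧ Tendsto (fun t => height w aRep (V t)) atTop atTop

/-- A vertical geodesic line (either orientation): a geodesic line whose image lies
in the boundary class, i.e. whose height tends to `+∞` along one of its ends. -/
def IsVerticalGeodesicLine (w : H) (aRep : ℝ → H) (V : ℝ → H) : Prop :=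
  IsGeodesicLine V ∧
    (Tendsto (fun t => height w aRep (V t)) atTop atTop ∨
     Tendsto (fun t => height w aRep (V t)) atBot atTop)

/-- A vertical geodesic parametrised by its height: `h(V(t)) = t` for all `t`. -/
def VertParam (w : H) (aRep : ℝ → H) (V : ℝ → H) : Prop :=
  IsGeodesicLine V ∧ ∀ t : ℝ, height w aRep (V t) = t

/-- Height difference `Δh(x,y)`. -/
def dh (w : H) (aRep : ℝ → H) (x y : H) : ℝ :=
  |height w aRep x - height w aRep y|

/-- Relative distance `d_r(x,y) = d(x,y) - Δh(x,y)`. -/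
def dr (w : H) (aRep : ℝ → H) (x y : H) : ℝ := dist x y - dh w aRep x y

/-- Maximal height `h⁺` of a path along the parameter set `I`. -/
def hplusOn (w : H) (aRep : ℝ → H) (γ : ℝ → H) (I : Set ℝ) : ℝ :=
  sSup ((fun t => height w aRep (γ t)) '' I)

/-- Minimal height `h⁻` of a path along the parameter set `I`. -/
def hminusOn (w : H) (aRep : ℝ → H) (γ : ℝ → H) (I : Set ℝ) : ℝ :=
  sInf ((fun t => height w aRep (γ t)) '' I)

/-- A path parametrised by arclength: the length of the piece on `[s,t]` equals `t - s`. -/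
def ArclengthPath (V : ℝ → H) : Prop :=
  ∀ s t : ℝ, s ≤ t → eVariationOn V (Set.Icc s t) = ENNReal.ofReal (t - s)

/-- An admissible norm on `ℝ²`: a norm with `N(1,1) = 1` and `N(a,b) ≥ (a+b)/2`. -/
structure AdmNorm where
  toFun : ℝ × ℝ → ℝ
  eq_zero_iff : ∀ v : ℝ × ℝ, toFun v = 0 ↔ v = 0
  smul_eq : ∀ (c : ℝ) (v : ℝ × ℝ), toFun (c • v) = |c| * toFun v
  add_le : ∀ v w : ℝ × ℝ, toFun (v + w) ≤ toFun v + toFun w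
  one_one : toFun (1, 1) = 1
  adm : ∀ a b : ℝ, (a + b) / 2 ≤ toFun (a, b)

/-- `C` is a comparison constant `C_N` for the admissible norm `N`:
`C ≥ 1` and `N(a,b) ≤ C(a+b)/2` for all `a,b ≥ 0`. -/
def AdmNorm.BoundConst (N : AdmNorm) (C : ℝ) : Prop :=
  1 ≤ C ∧ ∀ a b : ℝ, 0 ≤ a → 0 ≤ b → N.toFun (a, b) ≤ C * (a + b) / 2

variable {Hp Hq : Type*} [MetricSpace Hp] [MetricSpace Hq]

/-- Membership in the horospherical product: `h_p(x_p) + h_q(x_q) = 0`. -/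
def inHoro (wp : Hp) (ap : ℝ → Hp) (wq : Hq) (aq : ℝ → Hq) (z : Hp × Hq) : Prop :=
  height wp ap z.1 + height wq aq z.2 = 0

/-- The `N`-length of a path in `Hp × Hq`: supremum over finite monotone
subdivisions of the sums of the `N(d_p, d_q)`-distances. -/
def lN (Nf : ℝ × ℝ → ℝ) (γ : ℝ → Hp × Hq) (s : Set ℝ) : ℝ≥0∞ :=
  ⨆ p : ℕ × { u : ℕ → ℝ // Monotone u ∧ ∀ i, u i ∈ s },
    ∑ i ∈ Finset.range p.1,
      ENNReal.ofReal (Nf (dist (γ (p.2.1 (i+1))).1 (γ (p.2.1 i)).1,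
                          dist (γ (p.2.1 (i+1))).2 (γ (p.2.1 i)).2))

/-- The `N`-path metric: infimum of `N`-lengths of connected paths staying in the
horospherical product and joining the two points. -/
def dHN (Nf : ℝ × ℝ → ℝ) (mem : Hp × Hq → Prop) (x y : Hp × Hq) : ℝ≥0∞ :=
  ⨅ (T : ℝ) (_ : 0 ≤ T) (γ : ℝ → Hp × Hq) (_ : ContinuousOn γ (Set.Icc 0 T))
    (_ : ∀ t ∈ Set.Icc (0:ℝ) T, mem (γ t)) (_ : γ 0 = x) (_ : γ T = y),
    lN Nf γ (Set.Icc 0 T)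

/-- A geodesic of the horospherical product with respect to the `N`-path metric,
parametrised (by arclength) on `I` and staying in the product. -/
def IsHNGeodesicOn (Nf : ℝ × ℝ → ℝ) (mem : Hp × Hq → Prop)
    (α : ℝ → Hp × Hq) (I : Set ℝ) : Prop :=
  (∀ t ∈ I, mem (α t)) ∧
  ∀ s ∈ I, ∀ t ∈ I, dHN Nf mem (α s) (α t) = ENNReal.ofReal |s - t|

/-- A vertical geodesic of the horospherical product, parametrised by its height. -/
def IsHNVerticalLine (Nf : ℝ × ℝ → ℝ) (mem : Hp × Hq → Prop)
    (wp : Hp) (ap : ℝ → Hp) (V : ℝ → Hp × Hq) : Prop :=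
  IsHNGeodesicOn Nf mem V Set.univ ∧ ∀ t : ℝ, height wp ap (V t).1 = t

/-- Maximal height `h⁺` of a path of the horospherical product. -/
def hplusH (wp : Hp) (ap : ℝ → Hp) (γ : ℝ → Hp × Hq) (I : Set ℝ) : ℝ :=
  sSup ((fun t => height wp ap (γ t).1) '' I)

/-- Minimal height `h⁻` of a path of the horospherical product. -/
def hminusH (wp : Hp) (ap : ℝ → Hp) (γ : ℝ → Hp × Hq) (I : Set ℝ) : ℝ :=
  sInf ((fun t => height wp ap (γ t).1) '' I)

/-- `H_p`-type path at scale `κ`: the first component stays `κ`-close to a geodesic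
of `H_p` and the second component stays `κ`-close to a vertical geodesic of `H_q`. -/
def IsHpType (wq : Hq) (aq : ℝ → Hq) (κ : ℝ) (α : ℝ → Hp × Hq) : Prop :=
  (∃ g : ℝ → Hp, IsGeodesicLine g ∧ ∀ t : ℝ, ∃ s : ℝ, dist (α t).1 (g s) ≤ κ) ∧
  (∃ v : ℝ → Hq, IsVerticalGeodesicLine wq aq v ∧ ∀ t : ℝ, ∃ s : ℝ, dist (α t).2 (v s) ≤ κ)

/-- `H_q`-type path at scale `κ`. -/
def IsHqType (wp : Hp) (ap : ℝ → Hp) (κ : ℝ) (α : ℝ → Hp × Hq) : Prop :=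
  (∃ g : ℝ → Hq, IsGeodesicLine g ∧ ∀ t : ℝ, ∃ s : ℝ, dist (α t).2 (g s) ≤ κ) ∧
  (∃ v : ℝ → Hp, IsVerticalGeodesicLine wp ap v ∧ ∀ t : ℝ, ∃ s : ℝ, dist (α t).1 (v s) ≤ κ)

/-- Finite Hausdorff distance on `[0,∞)` between two rays, for a generalized
(`ℝ≥0∞`-valued) distance `dd`. -/
def HNFinHaus {X : Type*} (dd : X → X → ℝ≥0∞) (α β : ℝ → X) : Prop :=
  ∃ C : ℝ, (∀ s : ℝ, 0 ≤ s → ∃ t : ℝ, 0 ≤ t ∧ dd (α s) (β t) ≤ ENNReal.ofReal C) ∧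
           (∀ t : ℝ, 0 ≤ t → ∃ s : ℝ, 0 ≤ s ∧ dd (α s) (β t) ≤ ENNReal.ofReal C)

theorem finHaus_equivalence (H : Type*) [MetricSpace H] :
    Equivalence (fun γ₁ γ₂ : {γ : ℝ → H // IsGeodesicRay γ} => FinHausRays γ₁.1 γ₂.1) := by
  constructor
  · intro γ
    exact ⟨0, fun s hs => ⟨s, hs, by simp⟩, fun t ht => ⟨t, ht, by simp⟩⟩
  · rintro γ₁ γ₂ ⟨C, h1, h2⟩
    refine ⟨C, fun s hs => ?_, fun t ht => ?_⟩
    · obtain ⟨u, hu, hd⟩ := h2 s hs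
      exact ⟨u, hu, by rwa [dist_comm]⟩
    · obtain ⟨u, hu, hd⟩ := h1 t ht
      exact ⟨u, hu, by rwa [dist_comm]⟩
  · rintro γ₁ γ₂ γ₃ ⟨C, h1, h2⟩ ⟨D, g1, g2⟩
    refine ⟨C + D, fun s hs => ?_, fun t ht => ?_⟩
    · obtain ⟨u, hu, hd⟩ := h1 s hs
      obtain ⟨v, hv, he⟩ := g1 u hu
      exact ⟨v, hv, (dist_triangle _ (γ₂.1 u) _).trans (add_le_add hd he)⟩
    · obtain ⟨u, hu, hd⟩ := g2 t ht
      obtain ⟨v, hv, he⟩ := h2 u hu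
      exact ⟨v, hv, (dist_triangle _ (γ₂.1 u) _).trans (add_le_add he hd)⟩

/-- The setoid of geodesic rays up to finite Hausdorff distance. -/
instance raySetoid (H : Type*) [MetricSpace H] : Setoid {γ : ℝ → H // IsGeodesicRay γ} :=
  ⟨fun γ₁ γ₂ => FinHausRays γ₁.1 γ₂.1, finHaus_equivalence H⟩

/-- The Gromov boundary: equivalence classes of geodesic rays at finite
Hausdorff distance. -/
abbrev Bdry (H : Type*) [MetricSpace H] := Quotient (raySetoid H)

/-- The boundary point determined by a geodesic ray. -/
def bdryPt {H : Type*} [MetricSpace H] (γ : ℝ → H) (h : IsGeodesicRay γ) : Bdry H :=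
  Quotient.mk (raySetoid H) ⟨γ, h⟩

/-- The set `((∂H_p ∖ {a_p}) × {a_q}) ∪ ({a_p} × (∂H_q ∖ {a_q}))`. -/
def bdryTarget {Hp Hq : Type*} [MetricSpace Hp] [MetricSpace Hq]
    (ap : ℝ → Hp) (hap : IsGeodesicRay ap)
    (aq : ℝ → Hq) (haq : IsGeodesicRay aq) : Set (Bdry Hp × Bdry Hq) :=
  ((({bdryPt ap hap} : Set (Bdry Hp))ᶜ ×ˢ ({bdryPt aq haq} : Set (Bdry Hq))) ∪
   (({bdryPt ap hap} : Set (Bdry Hp)) ×ˢ ({bdryPt aq haq} : Set (Bdry Hq))ᶜ))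

section

open scoped Topology

/-- A continuous function reaches an intermediate value for a first time. -/
theorem exists_first_hit {g : ℝ → ℝ} (hg : Continuous g) {s t c : ℝ} (hst : s ≤ t)
    (hs : g s ≤ c) (ht : c ≤ g t) :
    ∃ u, s ≤ u ∧ u ≤ t ∧ g u = c ∧ ∀ r, s ≤ r → r ≤ u → g r ≤ c := by
  have hK : IsCompact (Set.Icc s t ∩ g ⁻¹' {c}) :=
    isCompact_Icc.inter_right (isClosed_singleton.preimage hg)
  have hne : (Set.Icc s t ∩ g ⁻¹' {c}).Nonempty := by
    obtain ⟨u, hu, huc⟩ := intermediate_value_Icc hst hg.continuousOn ⟨hs, ht⟩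
    exact ⟨u, hu, huc⟩
  obtain ⟨u, ⟨hu, huc⟩, hmin⟩ := hK.exists_isLeast hne
  refine ⟨u, hu.1, hu.2, huc, fun r hsr hru => ?_⟩
  by_contra! hlt
  obtain ⟨w, hw, hwc⟩ := intermediate_value_Icc hsr hg.continuousOn ⟨hs, hlt.le⟩
  have hle : u ≤ w := hmin ⟨⟨hw.1, hw.2.trans (hru.trans hu.2)⟩, hwc⟩
  have : w = r := le_antisymm hw.2 (hru.trans hle)
  subst this
  exact hlt.ne' hwc

/-- A quantity bounded linearly in terms of its dyadic logarithm is bounded. -/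
theorem exists_bound_of_le_log (a α β : ℝ) (ha : 0 < a) :
    ∃ R : ℝ, 0 ≤ R ∧ ∀ x : ℝ, (∀ k : ℕ, x ≤ 2 ^ k → a * x ≤ α + β * k) → x ≤ R := by
  have hlim : Tendsto (fun k : ℕ => (k : ℝ) / 2 ^ k) atTop (𝓝 0) := by
    simpa using tendsto_pow_const_div_const_pow_of_one_lt 1 (one_lt_two : (1 : ℝ) < 2)
  have hlim' : Tendsto (fun k : ℕ => (α + β) * ((1 / 2 : ℝ) ^ k) + β * ((k : ℝ) / 2 ^ k))
      atTop (𝓝 0) := by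
    simpa using ((tendsto_pow_atTop_nhds_zero_of_lt_one (by norm_num : (0 : ℝ) ≤ 1 / 2)
      (by norm_num)).const_mul (α + β)).add (hlim.const_mul β)
  obtain ⟨k₀, hk₀⟩ := eventually_atTop.1 (hlim'.eventually (gt_mem_nhds ha))
  have key : ∀ k : ℕ, k₀ ≤ k → α + β * ((k + 1 : ℕ) : ℝ) < a * 2 ^ k := by
    intro k hk
    have h := hk₀ k hk
    have h2 : (0 : ℝ) < 2 ^ k := by positivity
    have := mul_lt_mul_of_pos_right h h2
    calc α + β * ((k + 1 : ℕ) : ℝ)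
        = ((α + β) * (1 / 2) ^ k + β * (k / 2 ^ k)) * 2 ^ k := by
          push_cast
          rw [one_div, inv_pow]
          field_simp
          ring
      _ < a * 2 ^ k := this
  refine ⟨2 ^ k₀, by positivity, fun x hx => ?_⟩
  by_contra! hlt
  obtain ⟨n, hn⟩ := pow_unbounded_of_one_lt x (one_lt_two : (1 : ℝ) < 2)
  classical
  have hex : ∃ k : ℕ, x ≤ 2 ^ k := ⟨n, hn.le⟩
  have hspec := Nat.find_spec hex
  have hlt' : k₀ < Nat.find hex := by
    by_contra! hle
    exact absurd (hlt.trans_le hspec)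
      (not_lt.2 (pow_le_pow_right₀ (by norm_num : (1 : ℝ) ≤ 2) hle))
  obtain ⟨j, hj⟩ : ∃ j, Nat.find hex = j + 1 := ⟨Nat.find hex - 1, by omega⟩
  have hjlt : ¬ x ≤ 2 ^ j := Nat.find_min hex (by omega)
  rw [hj] at hspec
  have h1 := hx (j + 1) hspec
  have h2 := key j (by omega)
  have h3 := mul_lt_mul_of_pos_left (not_le.1 hjlt) ha
  linarith

/-- `P` is a coarse ultrametric which controls the heights `f` of a path at unit speed. -/
structure HeightKernel (f : ℝ → ℝ) (P : ℝ → ℝ → ℝ) (η : ℝ) : Prop where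
  nonneg : 0 ≤ η
  symm : ∀ s t, P s t = P t s
  ultra : ∀ s t u, P s u ≤ max (P s t) (P t u) + η
  le_left : ∀ s t, f s ≤ P s t
  le_add : ∀ s t, P s t ≤ |s - t| + f s
  cont : ∀ s, Continuous (P s)

namespace HeightKernel

variable {f : ℝ → ℝ} {P : ℝ → ℝ → ℝ} {η : ℝ}

theorem le_right (h : HeightKernel f P η) (s t : ℝ) : f t ≤ P s t := by
  rw [h.symm]; exact h.le_left t s

theorem le_add' (h : HeightKernel f P η) (s t : ℝ) : P s t ≤ |s - t| + f t := by
  rw [h.symm, abs_sub_comm]; exact h.le_add t s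

theorem sub_le (h : HeightKernel f P η) (s t : ℝ) : f s - f t ≤ |s - t| := by
  linarith [h.le_left s t, h.le_add' s t]

theorem continuous (h : HeightKernel f P η) : Continuous f := by
  have : LipschitzWith 1 f := LipschitzWith.of_dist_le_mul fun x y => by
    rw [Real.dist_eq, Real.dist_eq, NNReal.coe_one, one_mul, abs_le]
    have h1 := h.sub_le x y
    have h2 := h.sub_le y x
    rw [abs_sub_comm] at h2
    constructor <;> linarith
  exact this.continuous

theorem self (h : HeightKernel f P η) (s : ℝ) : P s s = f s := by
  have := h.le_add s s
  simp only [sub_self, abs_zero, zero_add] at this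
  exact le_antisymm this (h.le_left s s)

/-- Dyadic subdivision: the kernel exceeds the maximal height at most logarithmically. -/
theorem le_max_add (h : HeightKernel f P η) {M : ℝ} (k : ℕ) : ∀ {s t : ℝ}, s ≤ t →
    t - s ≤ 2 ^ k → (∀ u, s ≤ u → u ≤ t → f u ≤ M) → P s t ≤ M + 1 + k * η := by
  induction k with
  | zero =>
    intro s t hst hk hM
    have h1 := h.le_add s t
    have h2 := hM s le_rfl hst
    rw [abs_sub_comm, abs_of_nonneg (by linarith)] at h1
    simp only [pow_zero] at hk
    simp only [Nat.cast_zero, zero_mul]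
    linarith
  | succ k ih =>
    intro s t hst hk hM
    rw [pow_succ] at hk
    have h1 := ih (s := s) (t := (s + t) / 2) (by linarith) (by linarith)
      (fun u hu hu' => hM u hu (by linarith))
    have h2 := ih (s := (s + t) / 2) (t := t) (by linarith) (by linarith)
      (fun u hu hu' => hM u (by linarith) hu')
    have h3 := h.ultra s ((s + t) / 2) t
    have h4 := max_le h1 h2
    push_cast
    linarith

/-- On a piece which is monotone up to an error `E`, the kernel exceeds the maximal height
at most logarithmically in `E`. -/
theorem le_max_add_of_monotone (h : HeightKernel f P η) {M E : ℝ} (hE : 0 ≤ E) {k : ℕ}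
    (hk : E ≤ 2 ^ k) {s t : ℝ} (hst : s ≤ t) (hM : ∀ u, s ≤ u → u ≤ t → f u ≤ M)
    (hlen : t - s ≤ M - min (f s) (f t) + E) : P s t ≤ M + 1 + (k + 1) * η := by
  have hη := h.nonneg
  have hkη : 0 ≤ (k : ℝ) * η := by positivity
  rcases le_total (t - s) E with hle | hle
  · have := h.le_max_add k hst (hle.trans hk) hM
    linarith
  rcases le_total (f s) (f t) with hf | hf
  · rw [min_eq_left hf] at hlen
    have h1 := h.le_add s (t - E)
    rw [abs_sub_comm, abs_of_nonneg (by linarith)] at h1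
    have h2 := h.le_max_add k (s := t - E) (t := t) (by linarith) (by linarith)
      (fun u hu hu' => hM u (by linarith) hu')
    have h3 := h.ultra s (t - E) t
    have h4 : max (P s (t - E)) (P (t - E) t) ≤ M + 1 + k * η := max_le (by linarith) h2
    linarith
  · rw [min_eq_right hf] at hlen
    have h1 := h.le_add' (s + E) t
    rw [abs_sub_comm, abs_of_nonneg (by linarith)] at h1
    have h2 := h.le_max_add k (s := s) (t := s + E) (by linarith) (by linarith)
      (fun u hu hu' => hM u hu (by linarith))
    have h3 := h.ultra s (s + E) t
    have h4 : max (P s (s + E)) (P (s + E) t) ≤ M + 1 + k * η := max_le h2 (by linarith)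
    linarith

theorem le_of_three_pieces (h : HeightKernel f P η) {M E : ℝ} (hE : 0 ≤ E) {k : ℕ}
    (hk : E ≤ 2 ^ k) {s a b t : ℝ} (hsa : s ≤ a) (hab : a ≤ b) (hbt : b ≤ t)
    (hM : ∀ u, s ≤ u → u ≤ t → f u ≤ M)
    (h1 : a - s ≤ M - min (f s) (f a) + E) (h2 : b - a ≤ M - min (f a) (f b) + E)
    (h3 : t - b ≤ M - min (f b) (f t) + E) : P s t ≤ M + 1 + (k + 3) * η := by
  have p1 := h.le_max_add_of_monotone hE hk hsa (fun u hu hu' => hM u hu (by linarith)) h1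
  have p2 := h.le_max_add_of_monotone hE hk hab
    (fun u hu hu' => hM u (by linarith) (by linarith)) h2
  have p3 := h.le_max_add_of_monotone hE hk hbt (fun u hu hu' => hM u (by linarith) hu') h3
  have q1 := h.ultra s a b
  have q2 := h.ultra s b t
  have q3 := max_le p1 p2
  have hη := h.nonneg
  have q4 : max (P s b) (P b t) ≤ M + 1 + (k + 2) * η := max_le (by linarith) (by linarith)
  linarith

end HeightKernel

/-- The numerical data of a geodesic line of a horospherical product: heights `f`, the coarse
heights `P`, `Q` of the tops of the geodesics in both factors, lower bounds coming from the norm,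
and the upper bound on the length. -/
structure ProductKernel (f : ℝ → ℝ) (P Q : ℝ → ℝ → ℝ) (η c₀ c₁ A B C : ℝ) : Prop where
  kp : HeightKernel f P η
  kq : HeightKernel (fun t => -f t) Q η
  lower_p : ∀ s t, c₀ * (2 * P s t - f s - f t) - c₁ * (2 * Q s t + f s + f t) ≤ |s - t|
  lower_q : ∀ s t, c₁ * (2 * Q s t + f s + f t) - c₀ * (2 * P s t - f s - f t) ≤ |s - t|
  upper : ∀ s t, |s - t| ≤ |f s - f t| + A * (2 * P s t - f s - f t - |f s - f t|) +
    B * (2 * Q s t + f s + f t - |f s - f t|) + C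

namespace ProductKernel

variable {f : ℝ → ℝ} {P Q : ℝ → ℝ → ℝ} {η c₀ c₁ A B C : ℝ}

theorem swap (h : ProductKernel f P Q η c₀ c₁ A B C) :
    ProductKernel (fun t => -f t) Q P η c₁ c₀ B A C where
  kp := h.kq
  kq := by simpa using h.kp
  lower_p s t := by linarith [h.lower_q s t]
  lower_q s t := by linarith [h.lower_p s t]
  upper s t := by
    have h1 := h.upper s t
    have h2 : |-f s - -f t| = |f s - f t| := by rw [neg_sub_neg, abs_sub_comm]
    rw [h2]
    linarith

/-- If `N(1,0) > 1`, the heights make no long upward excursion. -/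
theorem exists_excursion_bound (η c₀ c₁ A B C : ℝ) (hc₀ : 1 < c₀) (hc₁ : 0 ≤ c₁) (hA : 1 ≤ A)
    (hB : 1 ≤ B) :
    ∃ R : ℝ, 0 ≤ R ∧ ∀ (f : ℝ → ℝ) (P Q : ℝ → ℝ → ℝ), ProductKernel f P Q η c₀ c₁ A B C →
      ∀ s t v, s ≤ t → f s = v → f t = v → (∀ u, s ≤ u → u ≤ t → v ≤ f u) → t - s ≤ R := by
  obtain ⟨R, hR, hbound⟩ := exists_bound_of_le_log (c₀ - 1)
    (c₀ * (2 * A * (2 + η) + 4 * B + 2 * C) + 2 * c₁)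
    (c₀ * (4 * A * η + 4 * B * η) + 2 * c₁ * η) (by linarith)
  refine ⟨R, hR, fun f P Q h s t v hst hs ht hv => hbound _ fun k hk => ?_⟩
  have hη := h.kp.nonneg
  set l : ℝ := 1 + k * η with hl
  have hl0 : 0 ≤ l := by positivity
  have hQ : ∀ u w, s ≤ u → u ≤ w → w ≤ t → Q u w ≤ -v + l := by
    intro u w hu huw hw
    have := h.kq.le_max_add (M := -v) k huw (by linarith)
      (fun r hr hr' => neg_le_neg (hv r (hu.trans hr) (hr'.trans hw)))
    rw [hl]; linarith
  have hv' : v ≤ P s t := by rw [← hs]; exact h.kp.le_left s t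
  obtain ⟨s₀, hss₀, hs₀t, hPs₀, hfirst⟩ := exists_first_hit (h.kp.cont s) hst
    (c := P s t) (by rw [h.kp.self, hs]; exact hv') le_rfl
  obtain ⟨s₁, hs₁, hmax⟩ := isCompact_Icc.exists_isMaxOn (nonempty_Icc.2 hss₀)
    h.kp.continuous.continuousOn
  have hs₁t : s₁ ≤ t := hs₁.2.trans hs₀t
  have htop : P s t ≤ f s₁ + l := by
    rw [← hPs₀, hl]
    have := h.kp.le_max_add (M := f s₁) k hss₀ (by linarith) (fun u hu hu' => hmax ⟨hu, hu'⟩)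
    linarith
  have hPs₁ : P s s₁ ≤ P s t := hfirst s₁ hs₁.1 hs₁.2
  have hfs₁ : f s₁ ≤ P s t := (h.kp.le_right s s₁).trans hPs₁
  have hvs₁ : v ≤ f s₁ := hv s₁ hs₁.1 hs₁t
  have hPs₁t : P s₁ t ≤ P s t + η := by
    have := h.kp.ultra s₁ s t
    rw [h.kp.symm s₁ s, max_eq_right hPs₁] at this
    exact this
  have hQ1 := hQ s s₁ le_rfl hs₁.1 hs₁t
  have hQ2 := hQ s₁ t hs₁.1 hs₁t le_rfl
  have hQ3 := hQ s t le_rfl hst le_rfl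
  have u1 := h.upper s s₁
  rw [abs_sub_comm, abs_of_nonneg (by linarith [hs₁.1] : 0 ≤ s₁ - s), abs_sub_comm (f s),
    abs_of_nonneg (by linarith : 0 ≤ f s₁ - f s), hs] at u1
  have u2 := h.upper s₁ t
  rw [abs_sub_comm, abs_of_nonneg (by linarith : 0 ≤ t - s₁),
    abs_of_nonneg (by linarith : 0 ≤ f s₁ - f t), ht] at u2
  have e1 : A * (2 * P s s₁ - v - f s₁ - (f s₁ - v)) ≤ A * (2 * l) :=
    mul_le_mul_of_nonneg_left (by linarith) (by linarith)
  have e2 : B * (2 * Q s s₁ + v + f s₁ - (f s₁ - v)) ≤ B * (2 * l) :=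
    mul_le_mul_of_nonneg_left (by linarith) (by linarith)
  have e3 : A * (2 * P s₁ t - f s₁ - v - (f s₁ - v)) ≤ A * (2 * l + 2 * η) :=
    mul_le_mul_of_nonneg_left (by linarith) (by linarith)
  have e4 : B * (2 * Q s₁ t + f s₁ + v - (f s₁ - v)) ≤ B * (2 * l) :=
    mul_le_mul_of_nonneg_left (by linarith) (by linarith)
  have hlen : t - s - (A * (4 * l + 2 * η) + 4 * B * l + 2 * C) ≤ 2 * (P s t - v) := by linarith
  have low := h.lower_p s t
  rw [abs_sub_comm, abs_of_nonneg (by linarith : 0 ≤ t - s), hs, ht] at low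
  have e5 : c₁ * (2 * Q s t + v + v) ≤ c₁ * (2 * l) :=
    mul_le_mul_of_nonneg_left (by linarith) hc₁
  have e6 := mul_le_mul_of_nonneg_left hlen (by linarith : 0 ≤ c₀)
  have e7 : c₀ * (t - s) - c₀ * (A * (4 * l + 2 * η) + 4 * B * l + 2 * C) ≤
      t - s + c₁ * (2 * l) := by linarith
  calc (c₀ - 1) * (t - s) ≤ c₀ * (A * (4 * l + 2 * η) + 4 * B * l + 2 * C) + c₁ * (2 * l) := by
        linarith
    _ = _ := by rw [hl]; ring

/-- If `N(1,0) > 1`, the heights are coarsely quasi-convex. -/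
theorem exists_quasiconvex_bound (η c₀ c₁ A B C : ℝ) (hc₀ : 1 < c₀) (hc₁ : 0 ≤ c₁) (hA : 1 ≤ A)
    (hB : 1 ≤ B) :
    ∃ R : ℝ, 0 ≤ R ∧ ∀ (f : ℝ → ℝ) (P Q : ℝ → ℝ → ℝ), ProductKernel f P Q η c₀ c₁ A B C →
      ∀ s r t, s ≤ r → r ≤ t → f r ≤ max (f s) (f t) + R := by
  obtain ⟨R, hR, hexc⟩ := exists_excursion_bound η c₀ c₁ A B C hc₀ hc₁ hA hB
  refine ⟨R, hR, fun f P Q h s r t hsr hrt => ?_⟩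
  set v := max (f s) (f t) with hv
  rcases le_total (f r) v with hle | hle
  · linarith
  have hf := h.kp.continuous
  obtain ⟨a, ha1, ha2, hfa, ha⟩ := exists_first_hit (g := fun u => -f (-u))
    (s := -r) (t := -s) (c := -v) (by fun_prop) (by linarith) (by simpa using hle)
    (by simp [hv])
  obtain ⟨b, hb1, hb2, hfb, hb⟩ := exists_first_hit (g := fun u => -f u)
    (s := r) (t := t) (c := -v) (by fun_prop) hrt (by simpa using hle) (by simp [hv])
  have hlen := hexc f P Q h (-a) b v (by linarith) (by simpa using hfa) (by simpa using hfb)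
    (fun u hu hu' => by
      rcases le_total u r with hur | hur
      · have := ha (-u) (by linarith) (by linarith)
        simp only [neg_neg] at this
        linarith
      · have := hb u hur hu'
        linarith)
  have := h.kp.sub_le r (-a)
  rw [abs_of_nonneg (by linarith)] at this
  simp only [neg_inj] at hfa
  linarith

/-- Both kernels stay boundedly close to the extremal heights, and the length of a piece is
controlled by the oscillation of the heights. -/
theorem exists_extremal_bound (η c₀ c₁ A B C : ℝ) (hc₀ : 0 ≤ c₀) (hc₁ : 0 ≤ c₁) (hA : 1 ≤ A)
    (hB : 1 ≤ B) (hC : 0 ≤ C) (hA' : A = 1 ∨ 1 < c₀) (hB' : B = 1 ∨ 1 < c₁) :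
    ∃ K : ℝ, 0 ≤ K ∧ ∀ (f : ℝ → ℝ) (P Q : ℝ → ℝ → ℝ), ProductKernel f P Q η c₀ c₁ A B C →
      (A = 1 ∨ ∀ s r t, s ≤ r → r ≤ t → f r ≤ max (f s) (f t) + K) ∧
      ∀ s t, s ≤ t → ∃ a b, s ≤ a ∧ a ≤ t ∧ s ≤ b ∧ b ≤ t ∧
        (∀ u, s ≤ u → u ≤ t → f a ≤ f u ∧ f u ≤ f b) ∧
        t - s ≤ 2 * (f b - f a) - |f s - f t| + K ∧
        P s t ≤ f b + K ∧ Q s t ≤ -f a + K := by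
  obtain ⟨R₁, hR₁, hconv⟩ : ∃ R : ℝ, 0 ≤ R ∧ ∀ (f : ℝ → ℝ) (P Q : ℝ → ℝ → ℝ),
      ProductKernel f P Q η c₀ c₁ A B C →
      A = 1 ∨ ∀ s r t, s ≤ r → r ≤ t → f r ≤ max (f s) (f t) + R := by
    rcases hA' with hA' | hA'
    · exact ⟨0, le_rfl, fun _ _ _ _ => Or.inl hA'⟩
    · obtain ⟨R, hR, h⟩ := exists_quasiconvex_bound η c₀ c₁ A B C hA' hc₁ hA hB
      exact ⟨R, hR, fun f P Q hk => Or.inr (h f P Q hk)⟩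
  obtain ⟨R₂, hR₂, hconc⟩ : ∃ R : ℝ, 0 ≤ R ∧ ∀ (f : ℝ → ℝ) (P Q : ℝ → ℝ → ℝ),
      ProductKernel f P Q η c₀ c₁ A B C →
      B = 1 ∨ ∀ s r t, s ≤ r → r ≤ t → min (f s) (f t) - R ≤ f r := by
    rcases hB' with hB' | hB'
    · exact ⟨0, le_rfl, fun _ _ _ _ => Or.inl hB'⟩
    · obtain ⟨R, hR, h⟩ := exists_quasiconvex_bound η c₁ c₀ B A C hB' hc₀ hB hA
      refine ⟨R, hR, fun f P Q hk => Or.inr fun s r t hsr hrt => ?_⟩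
      have := h _ Q P hk.swap s r t hsr hrt
      rw [max_neg_neg] at this
      linarith
  set K₁ : ℝ := 2 * A + 2 * B with hK₁
  set K₂ : ℝ := 2 * A * R₁ + 2 * B * R₂ + C with hK₂
  have hK₂0 : 0 ≤ K₂ := by positivity
  obtain ⟨R, hR, hbound⟩ := exists_bound_of_le_log 1 (K₁ * (1 + 3 * |η|) + K₂) (K₁ * |η|) one_pos
  refine ⟨R + R₁, by linarith, fun f P Q h => ⟨?_, fun s t hst => ?_⟩⟩
  · rcases hconv f P Q h with h1 | h1
    · exact Or.inl h1
    · exact Or.inr fun s r t hsr hrt => (h1 s r t hsr hrt).trans (by linarith)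
  have hη := h.kp.nonneg
  rw [abs_of_nonneg hη] at hbound
  have hf := h.kp.continuous
  obtain ⟨a, ha, hmin⟩ := isCompact_Icc.exists_isMinOn (nonempty_Icc.2 hst) hf.continuousOn
  obtain ⟨b, hb, hmax⟩ := isCompact_Icc.exists_isMaxOn (nonempty_Icc.2 hst) hf.continuousOn
  have hfa : ∀ u, s ≤ u → u ≤ t → f a ≤ f u := fun u hu hu' => hmin ⟨hu, hu'⟩
  have hfb : ∀ u, s ≤ u → u ≤ t → f u ≤ f b := fun u hu hu' => hmax ⟨hu, hu'⟩
  set D : ℝ := max 0 (max (P s t - f b) (Q s t + f a)) with hD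
  have hD0 : 0 ≤ D := le_max_left _ _
  have hDP : P s t - f b ≤ D := (le_max_left _ _).trans (le_max_right _ _)
  have hDQ : Q s t + f a ≤ D := (le_max_right _ _).trans (le_max_right _ _)
  set E : ℝ := K₁ * D + K₂ with hE
  have hE0 : 0 ≤ E := by positivity
  have hmaxabs : 2 * max (f s) (f t) = f s + f t + |f s - f t| := by
    rcases le_total (f s) (f t) with h1 | h1
    · rw [max_eq_right h1, abs_of_nonpos (by linarith)]; ring
    · rw [max_eq_left h1, abs_of_nonneg (by linarith)]; ring
  have hminabs : 2 * min (f s) (f t) = f s + f t - |f s - f t| := by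
    rcases le_total (f s) (f t) with h1 | h1
    · rw [min_eq_left h1, abs_of_nonpos (by linarith)]; ring
    · rw [min_eq_right h1, abs_of_nonneg (by linarith)]; ring
  have hmaxb : max (f s) (f t) ≤ f b := max_le (hfb s le_rfl hst) (hfb t hst le_rfl)
  have hmina : f a ≤ min (f s) (f t) := le_min (hfa s le_rfl hst) (hfa t hst le_rfl)
  have hlen : t - s ≤ 2 * (f b - f a) - |f s - f t| + E := by
    have u := h.upper s t
    rw [abs_sub_comm, abs_of_nonneg (by linarith : 0 ≤ t - s)] at u
    have u1 : A * (2 * P s t - f s - f t - |f s - f t|) ≤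
        2 * (f b - max (f s) (f t)) + 2 * A * D + 2 * A * R₁ := by
      have : A * (2 * P s t - f s - f t - |f s - f t|) ≤
          A * (2 * (f b - max (f s) (f t)) + 2 * D) :=
        mul_le_mul_of_nonneg_left (by linarith) (by linarith)
      have hAR : 0 ≤ A * R₁ := by positivity
      rcases hconv f P Q h with h1 | h1
      · rw [h1] at this hAR ⊢; linarith
      · have h2 := h1 s b t hb.1 hb.2
        have h3 : A * (2 * (f b - max (f s) (f t)) + 2 * D) ≤ A * (2 * R₁ + 2 * D) :=
          mul_le_mul_of_nonneg_left (by linarith) (by linarith)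
        linarith
    have u2 : B * (2 * Q s t + f s + f t - |f s - f t|) ≤
        2 * (min (f s) (f t) - f a) + 2 * B * D + 2 * B * R₂ := by
      have : B * (2 * Q s t + f s + f t - |f s - f t|) ≤
          B * (2 * (min (f s) (f t) - f a) + 2 * D) :=
        mul_le_mul_of_nonneg_left (by linarith) (by linarith)
      have hBR : 0 ≤ B * R₂ := by positivity
      rcases hconc f P Q h with h1 | h1
      · rw [h1] at this hBR ⊢; linarith
      · have h2 := h1 s a t ha.1 ha.2
        have h3 : B * (2 * (min (f s) (f t) - f a) + 2 * D) ≤ B * (2 * R₂ + 2 * D) :=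
          mul_le_mul_of_nonneg_left (by linarith) (by linarith)
        linarith
    rw [hE, hK₁, hK₂]
    linarith
  have lip : ∀ u w, u ≤ w → f u - f w ≤ w - u ∧ f w - f u ≤ w - u := by
    intro u w huw
    have h1 := h.kp.sub_le u w
    have h2 := h.kp.sub_le w u
    rw [abs_sub_comm, abs_of_nonneg (by linarith)] at h1
    rw [abs_of_nonneg (by linarith)] at h2
    exact ⟨h1, h2⟩
  have hs1 := hfa s le_rfl hst
  have hs2 := hfb s le_rfl hst
  have ht1 := hfa t hst le_rfl
  have ht2 := hfb t hst le_rfl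
  have habs1 := le_abs_self (f s - f t)
  have habs2 := neg_abs_le (f s - f t)
  have hab := hfa b hb.1 hb.2
  have hDk : ∀ k : ℕ, E ≤ 2 ^ k → D ≤ 1 + (k + 3) * η := by
    intro k hk
    have hMQ : ∀ u, s ≤ u → u ≤ t → -f u ≤ -f a := fun u hu hu' => neg_le_neg (hfa u hu hu')
    have main : P s t ≤ f b + 1 + (k + 3) * η ∧ Q s t ≤ -f a + 1 + (k + 3) * η := by
      rcases le_total a b with hle | hle
      · have l1 := lip s a ha.1
        have l2 := lip a b hle
        have l3 := lip b t hb.2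
        constructor
        · apply h.kp.le_of_three_pieces hE0 hk ha.1 hle hb.2 hfb
          · rw [min_eq_right hs1]; linarith
          · rw [min_eq_left hab]; linarith
          · rw [min_eq_right ht2]; linarith
        · apply h.kq.le_of_three_pieces hE0 hk ha.1 hle hb.2 hMQ
          · rw [min_eq_left (neg_le_neg hs1)]; linarith
          · rw [min_eq_right (neg_le_neg hab)]; linarith
          · rw [min_eq_left (neg_le_neg ht2)]; linarith
      · have l1 := lip s b hb.1
        have l2 := lip b a hle
        have l3 := lip a t ha.2
        constructor
        · apply h.kp.le_of_three_pieces hE0 hk hb.1 hle ha.2 hfb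
          · rw [min_eq_left hs2]; linarith
          · rw [min_eq_right hab]; linarith
          · rw [min_eq_left ht1]; linarith
        · apply h.kq.le_of_three_pieces hE0 hk hb.1 hle ha.2 hMQ
          · rw [min_eq_right (neg_le_neg hs2)]; linarith
          · rw [min_eq_left (neg_le_neg hab)]; linarith
          · rw [min_eq_right (neg_le_neg ht1)]; linarith
    have hkη : 0 ≤ ((k : ℝ) + 3) * η := by positivity
    exact max_le (by linarith) (max_le (by linarith [main.1]) (by linarith [main.2]))
  have hER : E ≤ R := hbound E fun k hk => by
    have := mul_le_mul_of_nonneg_left (hDk k hk) (by positivity : 0 ≤ K₁)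
    rw [hE]
    linarith
  have hDE : D ≤ E := by
    have : 1 * D ≤ K₁ * D := mul_le_mul_of_nonneg_right (by linarith) hD0
    linarith
  exact ⟨a, b, ha.1, ha.2, hb.1, hb.2, fun u hu hu' => ⟨hfa u hu hu', hfb u hu hu'⟩,
    by linarith, by linarith, by linarith⟩

end ProductKernel

/-- If a `1`-Lipschitz function descends and climbs back by more than `K`, and its oscillation
controls lengths, then its minimum over any larger interval is attained in the valley. -/
theorem argmin_mem_of_valley {f : ℝ → ℝ} {K : ℝ} (hK : 0 ≤ K)
    (hf : ∀ s t, s ≤ t → |f s - f t| ≤ t - s) {s₁ r₁ t₁ : ℝ} (hsr : s₁ ≤ r₁) (hrt : r₁ ≤ t₁)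
    (hs₁ : f r₁ + K < f s₁) (ht₁ : f r₁ + K < f t₁) {s t a b : ℝ} (hs : s ≤ s₁) (ht : t₁ ≤ t)
    (hsa : s ≤ a) (hat : a ≤ t) (hsb : s ≤ b) (hbt : b ≤ t)
    (hlen : t - s ≤ 2 * (f b - f a) - |f s - f t| + K) : s₁ ≤ a ∧ a ≤ t₁ := by
  have L : ∀ x y, x ≤ y → f x - f y ≤ y - x ∧ f y - f x ≤ y - x := fun x y hxy =>
    ⟨(le_abs_self _).trans (hf x y hxy), by
      rw [← neg_sub]; exact (neg_le_abs _).trans (hf x y hxy)⟩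
  have e1 := le_abs_self (f s - f t)
  have e2 := neg_le_abs (f s - f t)
  constructor
  · by_contra! h
    rcases le_total a b with hab | hba
    · rcases le_total b r₁ with hb | hb
      · linarith [L s a hsa, L a b hab, L b r₁ hb, L r₁ t₁ hrt, L t₁ t ht]
      · linarith [L s a hsa, L a s₁ h.le, L s₁ r₁ hsr, L r₁ b hb, L b t hbt]
    · linarith [L s b hsb, L b a hba, L a s₁ h.le, L s₁ r₁ hsr, L r₁ t (hrt.trans ht)]
  · by_contra! h
    rcases le_total b a with hba | hab
    · rcases le_total b r₁ with hb | hb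
      · linarith [L s b hsb, L b r₁ hb, L r₁ t₁ hrt, L t₁ a h.le, L a t hat]
      · linarith [L s s₁ hs, L s₁ r₁ hsr, L r₁ b hb, L b a hba, L a t hat]
    · linarith [L s r₁ (hs.trans hsr), L r₁ t₁ hrt, L t₁ a h.le, L a b hab, L b t hbt]

theorem quasiconcave_or_quasiconvex {f : ℝ → ℝ} {K : ℝ} (hK : 0 ≤ K)
    (hf : ∀ s t, s ≤ t → |f s - f t| ≤ t - s)
    (hext : ∀ s t, s ≤ t → ∃ a b, s ≤ a ∧ a ≤ t ∧ s ≤ b ∧ b ≤ t ∧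
      t - s ≤ 2 * (f b - f a) - |f s - f t| + K) :
    (∀ s r t, s ≤ r → r ≤ t → min (f s) (f t) ≤ f r + K) ∨
      ∀ s r t, s ≤ r → r ≤ t → f r ≤ max (f s) (f t) + K := by
  by_contra! hcon
  obtain ⟨⟨s₁, r₁, t₁, hsr, hrt, hv⟩, s₂, r₂, t₂, hsr', hrt', hp⟩ := hcon
  obtain ⟨hv1, hv2⟩ := lt_min_iff.1 hv
  have hp' : max (f s₂) (f t₂) < f r₂ - K := by linarith
  obtain ⟨hp1, hp2⟩ := max_lt_iff.1 hp'
  set m := min s₁ s₂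
  set M := max t₁ t₂
  have m1 : m ≤ s₁ := min_le_left _ _
  have m2 : m ≤ s₂ := min_le_right _ _
  have M1 : t₁ ≤ M := le_max_left _ _
  have M2 : t₂ ≤ M := le_max_right _ _
  have hmM : m ≤ M := by linarith
  obtain ⟨a, b, hsa, hat, hsb, hbt, hlen⟩ := hext (m - (M - m + K + 1)) (M + (M - m + K + 1))
    (by linarith)
  have ha := argmin_mem_of_valley hK hf hsr hrt hv1 hv2 (by linarith) (by linarith)
    hsa hat hsb hbt hlen
  have hb := argmin_mem_of_valley (f := fun t => -f t) hK
    (fun s t hst => by rw [neg_sub_neg, abs_sub_comm]; exact hf s t hst) hsr' hrt'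
    (by linarith) (by linarith) (by linarith) (by linarith) hsb hbt hsa hat
    (by rw [neg_sub_neg, neg_sub_neg, abs_sub_comm]; exact hlen)
  have := abs_nonneg (f (m - (M - m + K + 1)) - f (M + (M - m + K + 1)))
  rcases le_total a b with h | h
  · have := (neg_le_abs _).trans (hf a b h)
    linarith
  · have := (le_abs_self _).trans (hf b a h)
    linarith

namespace ProductKernel

variable {f : ℝ → ℝ} {P Q : ℝ → ℝ → ℝ} {η c₀ c₁ A B C : ℝ}

theorem length_of_quasiconcave (hA : 1 ≤ A) (hB : 1 ≤ B) (hC : 0 ≤ C) {K : ℝ} (hK : 0 ≤ K)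
    (h : ProductKernel f P Q η c₀ c₁ A B C)
    (hAK : A = 1 ∨ ∀ s r t, s ≤ r → r ≤ t → f r ≤ max (f s) (f t) + K)
    (hext : ∀ s t, s ≤ t → ∃ a b, s ≤ a ∧ a ≤ t ∧ s ≤ b ∧ b ≤ t ∧
      P s t ≤ f b + K ∧ Q s t ≤ -f a + K)
    (hconc : ∀ s r t, s ≤ r → r ≤ t → min (f s) (f t) ≤ f r + K) (s t : ℝ) :
    2 * Q s t + f s + f t ≤ |f s - f t| + (4 * K + 4 * A * K + 4 * B * K + C) ∧
      |(2 * P s t - f s - f t) - abs (s - t)| ≤ 4 * K + 4 * A * K + 4 * B * K + C := by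
  wlog hst : s ≤ t generalizing s t
  · have := this t s (le_of_not_ge hst)
    rw [h.kp.symm s t, h.kq.symm s t, abs_sub_comm s t, abs_sub_comm (f s)]
    constructor
    · linarith [this.1]
    · convert this.2 using 3; ring
  obtain ⟨a, b, hsa, hat, hsb, hbt, hP, hQ⟩ := hext s t hst
  have hAK0 : 0 ≤ A * K := by positivity
  have hBK0 : 0 ≤ B * K := by positivity
  have hmin : min (f s) (f t) = (f s + f t - |f s - f t|) / 2 := by
    rcases le_total (f s) (f t) with h | h
    · rw [min_eq_left h, abs_of_nonpos (by linarith)]; ring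
    · rw [min_eq_right h, abs_of_nonneg (by linarith)]; ring
  have hmax : max (f s) (f t) = (f s + f t + |f s - f t|) / 2 := by
    rcases le_total (f s) (f t) with h | h
    · rw [max_eq_right h, abs_of_nonpos (by linarith)]; ring
    · rw [max_eq_left h, abs_of_nonneg (by linarith)]; ring
  have h1 := hconc s a t hsa hat
  rw [hmin] at h1
  have hq : 2 * Q s t + f s + f t - |f s - f t| ≤ 4 * K := by linarith
  have hpQ := mul_le_mul_of_nonneg_left hq (by linarith : 0 ≤ B)
  have hup := h.upper s t
  have h2 := h.kp.sub_le b s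
  have h3 := h.kp.sub_le b t
  rw [abs_of_nonneg (by linarith)] at h2
  rw [abs_of_nonpos (by linarith)] at h3
  have h4 : |s - t| = t - s := by rw [abs_of_nonpos (by linarith)]; ring
  refine ⟨by linarith, abs_le.2 ⟨?_, by linarith⟩⟩
  rcases hAK with rfl | hAK
  · linarith
  · have h5 := hAK s b t hsb hbt
    rw [hmax] at h5
    have h6 : 2 * P s t - f s - f t - |f s - f t| ≤ 4 * K := by linarith
    have h7 := mul_le_mul_of_nonneg_left h6 (by linarith : 0 ≤ A)
    have h8 : |f s - f t| ≤ 2 * P s t - f s - f t := by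
      have := h.kp.le_left s t
      have := h.kp.le_right s t
      rw [abs_le]; constructor <;> linarith
    linarith

/-- In one factor the relative distance is bounded and in the other one distances agree with the
parameter, up to a uniform constant. -/
theorem exists_dichotomy_bound (η c₀ c₁ A B C : ℝ) (hc₀ : 0 ≤ c₀) (hc₁ : 0 ≤ c₁) (hA : 1 ≤ A)
    (hB : 1 ≤ B) (hC : 0 ≤ C) (hA' : A = 1 ∨ 1 < c₀) (hB' : B = 1 ∨ 1 < c₁) :
    ∃ K : ℝ, 0 ≤ K ∧ ∀ (f : ℝ → ℝ) (P Q : ℝ → ℝ → ℝ), ProductKernel f P Q η c₀ c₁ A B C →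
      (∀ s t, 2 * Q s t + f s + f t ≤ |f s - f t| + K ∧
        |(2 * P s t - f s - f t) - abs (s - t)| ≤ K) ∨
      (∀ s t, 2 * P s t - f s - f t ≤ |f s - f t| + K ∧
        |(2 * Q s t + f s + f t) - abs (s - t)| ≤ K) := by
  obtain ⟨K₁, hK₁, h₁⟩ := exists_extremal_bound η c₀ c₁ A B C hc₀ hc₁ hA hB hC hA' hB'
  obtain ⟨K₂, hK₂, h₂⟩ := exists_extremal_bound η c₁ c₀ B A C hc₁ hc₀ hB hA hC hB' hA'
  set K := max K₁ K₂
  have hK : 0 ≤ K := hK₁.trans (le_max_left _ _)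
  have k1 : K₁ ≤ K := le_max_left _ _
  have k2 : K₂ ≤ K := le_max_right _ _
  refine ⟨4 * K + 4 * A * K + 4 * B * K + C, by positivity, fun f P Q h => ?_⟩
  obtain ⟨hAK, hext⟩ := h₁ f P Q h
  obtain ⟨hBK, -⟩ := h₂ _ _ _ h.swap
  have hlip : ∀ s t, s ≤ t → |f s - f t| ≤ t - s := by
    intro s t hst
    have e1 := h.kp.sub_le s t
    have e2 := h.kp.sub_le t s
    rw [abs_of_nonpos (by linarith)] at e1
    rw [abs_of_nonneg (by linarith)] at e2
    rw [abs_le]; constructor <;> linarith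
  have hext' : ∀ s t, s ≤ t → ∃ a b, s ≤ a ∧ a ≤ t ∧ s ≤ b ∧ b ≤ t ∧
      t - s ≤ 2 * (f b - f a) - |f s - f t| + K := fun s t hst => by
    obtain ⟨a, b, h1, h2, h3, h4, -, h5, -, -⟩ := hext s t hst
    exact ⟨a, b, h1, h2, h3, h4, by linarith⟩
  rcases quasiconcave_or_quasiconvex hK hlip hext' with hc | hc
  · refine Or.inl fun s t => length_of_quasiconcave hA hB hC hK h (hAK.imp_right fun hq s r t
      h1 h2 => (hq s r t h1 h2).trans (by linarith)) (fun s t hst => ?_) hc s t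
    obtain ⟨a, b, h1, h2, h3, h4, -, -, h5, h6⟩ := hext s t hst
    exact ⟨a, b, h1, h2, h3, h4, by linarith, by linarith⟩
  · refine Or.inr fun s t => ?_
    have := length_of_quasiconcave hB hA hC hK h.swap (hBK.imp_right fun hq s r t
      h1 h2 => (hq s r t h1 h2).trans (by linarith)) (fun s t hst => ?_)
      (fun s r t h1 h2 => ?_) s t
    · rw [neg_sub_neg, abs_sub_comm (f t)] at this
      constructor
      · linarith [this.1]
      · convert this.2 using 1
        · congr 1; ring
        · ring
    · obtain ⟨a, b, h1, h2, h3, h4, -, -, h5, h6⟩ := hext s t hst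
      exact ⟨b, a, h3, h4, h1, h2, by linarith, by simpa using by linarith⟩
    · have := hc s r t h1 h2
      rw [min_neg_neg]
      linarith

end ProductKernel

theorem IsGeodesicLine.dist_eq {g : ℝ → H} (hg : IsGeodesicLine g) (s t : ℝ) :
    dist (g s) (g t) = |s - t| := hg s trivial t trivial

theorem IsGeodesicLine.of_dist_eq {g : ℝ → H} (hg : ∀ s t, dist (g s) (g t) = |s - t|) :
    IsGeodesicLine g := fun s _ t _ => hg s t

theorem IsGeodesicLine.comp_add {g : ℝ → H} (hg : IsGeodesicLine g) (c : ℝ) :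
    IsGeodesicLine fun t => g (c + t) :=
  .of_dist_eq fun s t => by rw [hg.dist_eq]; congr 1; ring

theorem IsGeodesicLine.continuous {g : ℝ → H} (hg : IsGeodesicLine g) : Continuous g :=
  (LipschitzWith.of_dist_le_mul (K := 1) fun s t => by
    rw [hg.dist_eq, Real.dist_eq, NNReal.coe_one, one_mul]).continuous

theorem IsGeodesicLine.isGeodSegment {g : ℝ → H} (hg : IsGeodesicLine g) {x y : H}
    (h0 : g 0 = x) (h1 : g (dist x y) = y) : IsGeodSegment g x y :=
  ⟨fun s _ t _ => hg.dist_eq s t, h0, h1⟩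

/-- The standing assumptions on a factor of a horospherical product. -/
structure IsHorofactor (δ : ℝ) (w : H) (a : ℝ → H) : Prop where
  nonneg : 0 ≤ δ
  hyp : DeltaHyperbolic H δ
  bus : BusemannSpace H
  complete : GeodesicallyComplete H
  ray : IsRayFrom w a

theorem ray_eqOn_of_finHausRays (hB : BusemannSpace H) {w : H} {a k : ℝ → H}
    (ha : IsRayFrom w a) (hk : IsRayFrom w k) (hak : FinHausRays a k) {t : ℝ} (ht : 0 ≤ t) :
    k t = a t := by
  obtain ⟨C, hC, -⟩ := hak
  have hbd : ∀ s, 0 ≤ s → dist (a s) (k s) ≤ 2 * C := by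
    intro s hs
    obtain ⟨u, hu, hd⟩ := hC s hs
    have h1 : dist (a s) w = s := by
      rw [← ha.2, ha.1 s hs 0 self_mem_Ici, sub_zero, abs_of_nonneg hs]
    have h2 : dist (k u) w = u := by
      rw [← hk.2, hk.1 u hu 0 self_mem_Ici, sub_zero, abs_of_nonneg hu]
    have h3 : dist (k u) (k s) = |u - s| := hk.1 u hu s hs
    have h4 : |u - s| ≤ dist (a s) (k u) := by
      have := abs_dist_sub_le (k u) (a s) w
      rwa [h1, h2, dist_comm (k u)] at this
    linarith [dist_triangle (a s) (k u) (k s)]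
  by_contra hne
  have hd : 0 < dist (a t) (k t) := dist_pos.2 (Ne.symm hne)
  have hC0 : 0 ≤ C := by linarith [hbd t ht]
  set R := t + 1 + t * (2 * C) / dist (a t) (k t) with hR
  have hq : 0 ≤ t * (2 * C) / dist (a t) (k t) := by positivity
  have hR0 : 0 < R := by linarith
  have hconv := hB.2 0 R 0 R a k (fun s hs u hu => ha.1 s hs.1 u hu.1)
    (fun s hs u hu => hk.1 s hs.1 u hu.1)
  have h1 := hconv.2 (by simp [hR0.le] : ((0 : ℝ), (0 : ℝ)) ∈ Icc 0 R ×ˢ Icc 0 R)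
    (by simp [hR0.le] : (R, R) ∈ Icc 0 R ×ˢ Icc 0 R)
    (by rw [sub_nonneg, div_le_one hR0]; linarith : 0 ≤ 1 - t / R)
    (by positivity : 0 ≤ t / R) (by ring)
  have h2 : t / R * R = t := by field_simp
  simp only [Prod.smul_mk, Prod.mk_add_mk, mul_zero, zero_add, smul_eq_mul, h2, ha.2, hk.2,
    dist_self] at h1
  have h3 : dist (a t) (k t) ≤ t / R * (2 * C) :=
    h1.trans (mul_le_mul_of_nonneg_left (hbd R hR0.le) (by positivity))
  have h4 : dist (a t) (k t) * R ≤ t * (2 * C) := by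
    calc dist (a t) (k t) * R ≤ t / R * (2 * C) * R := by gcongr
      _ = t * (2 * C) := by field_simp
  have h5 : dist (a t) (k t) * R = dist (a t) (k t) * (t + 1) + t * (2 * C) := by
    rw [hR]; field_simp
  nlinarith

namespace IsHorofactor

variable {δ : ℝ} {w : H} {a : ℝ → H}

theorem dist_ray (h : IsHorofactor δ w a) {s t : ℝ} (hs : 0 ≤ s) (ht : 0 ≤ t) :
    dist (a s) (a t) = |s - t| := h.ray.1 s hs t ht

theorem tendsto_height (h : IsHorofactor δ w a) (x : H) :
    Tendsto (fun t => t - dist x (a t)) atTop (𝓝 (height w a x)) := by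
  have hanti : Antitone fun t : ℝ => dist x (a (max t 0)) - max t 0 := by
    intro s t hst
    have h1 := h.dist_ray (le_max_right s 0) (le_max_right t 0)
    have h2 : max s 0 ≤ max t 0 := max_le_max_right 0 hst
    rw [abs_of_nonpos (by linarith)] at h1
    have := dist_triangle x (a (max s 0)) (a (max t 0))
    dsimp only
    linarith
  have hbdd : BddBelow (range fun t : ℝ => dist x (a (max t 0)) - max t 0) := by
    refine ⟨-dist x w, ?_⟩
    rintro _ ⟨t, rfl⟩
    have h1 := h.dist_ray le_rfl (le_max_right t 0)
    rw [h.ray.2, abs_of_nonpos (by linarith [le_max_right t 0])] at h1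
    have := dist_triangle w x (a (max t 0))
    rw [dist_comm w x] at this
    dsimp only
    linarith
  have hlim : Tendsto (fun t => dist x (a t) - t) atTop
      (𝓝 (⨅ t, (dist x (a (max t 0)) - max t 0))) := by
    refine (tendsto_atTop_ciInf hanti hbdd).congr' ?_
    filter_upwards [eventually_ge_atTop 0] with t ht
    rw [max_eq_left ht]
  set L := ⨅ t, (dist x (a (max t 0)) - max t 0)
  have hset : { b : ℝ | ∃ k : ℝ → H, IsRayFrom w k ∧ FinHausRays a k ∧
      b = Filter.limsup (fun t => dist x (k t) - t) Filter.atTop } = {L} := by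
    ext b
    simp only [mem_ofPred_eq, mem_singleton_iff]
    constructor
    · rintro ⟨k, hk, hak, rfl⟩
      refine (hlim.congr' ?_).limsup_eq
      filter_upwards [eventually_ge_atTop 0] with t ht
      rw [ray_eqOn_of_finHausRays h.bus h.ray hk hak ht]
    · rintro rfl
      exact ⟨a, h.ray, ⟨0, fun s hs => ⟨s, hs, by simp⟩, fun s hs => ⟨s, hs, by simp⟩⟩,
        hlim.limsup_eq.symm⟩
  rw [height, busemann, hset, csSup_singleton]
  exact hlim.neg.congr fun t => by ring

theorem height_sub_le (h : IsHorofactor δ w a) (x y : H) :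
    height w a x - height w a y ≤ dist x y :=
  le_of_tendsto ((h.tendsto_height x).sub (h.tendsto_height y)) (Eventually.of_forall fun t => by
    linarith [dist_triangle_left y (a t) x])

theorem abs_height_sub_le (h : IsHorofactor δ w a) (x y : H) :
    |height w a x - height w a y| ≤ dist x y := by
  rw [abs_le]
  have := h.height_sub_le x y
  have := h.height_sub_le y x
  rw [dist_comm] at this
  constructor <;> linarith

theorem continuous_height (h : IsHorofactor δ w a) : Continuous (height w a) :=
  (LipschitzWith.of_dist_le_mul (K := 1) fun s t => by
    rw [Real.dist_eq, NNReal.coe_one, one_mul]; exact h.abs_height_sub_le s t).continuous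

theorem exists_line (h : IsHorofactor δ w a) (x y : H) :
    ∃ g : ℝ → H, IsGeodesicLine g ∧ g 0 = x ∧ g (dist x y) = y := by
  obtain ⟨γ, hγ, h0, h1⟩ := h.hyp.1 x y
  obtain ⟨g, hg, hgγ⟩ := h.complete 0 (dist x y) γ dist_nonneg hγ
  exact ⟨g, hg, by rw [hgγ 0 (by simp), h0], by rw [hgγ _ (by simp), h1]⟩

/-- On a side of a triangle there is a point which is close to both other sides. -/
theorem exists_center (h : IsHorofactor δ w a) (x y z : H) {g : ℝ → H} (hg : IsGeodesicLine g)
    (h0 : g 0 = x) (h1 : g (dist x y) = y) :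
    ∃ s, 0 ≤ s ∧ s ≤ dist x y ∧ dist y (g s) + dist (g s) z ≤ dist y z + 2 * δ ∧
      dist x (g s) + dist (g s) z ≤ dist x z + 2 * δ := by
  obtain ⟨g₂, hg₂, h20, h21⟩ := h.exists_line y z
  obtain ⟨g₃, hg₃, h30, h31⟩ := h.exists_line z x
  set S₂ := g₂ '' Icc 0 (dist y z)
  set S₃ := g₃ '' Icc 0 (dist z x)
  have hS₂ : IsCompact S₂ := isCompact_Icc.image hg₂.continuous
  have hS₃ : IsCompact S₃ := isCompact_Icc.image hg₃.continuous
  have hy : y ∈ S₂ := ⟨0, by simp, h20⟩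
  have hx : x ∈ S₃ := ⟨dist z x, by simp, h31⟩
  have hclosed : ∀ S : Set H, IsClosed {s | Metric.infDist (g s) S ≤ δ} := fun S =>
    isClosed_le ((Metric.continuous_infDist_pt S).comp hg.continuous) continuous_const
  have hne := isPreconnected_closed_iff.1 (isPreconnected_Icc (a := 0) (b := dist x y))
    {s | Metric.infDist (g s) S₂ ≤ δ} {s | Metric.infDist (g s) S₃ ≤ δ} (hclosed _) (hclosed _)
    (fun s hs => by
      obtain ⟨u, hu, hd⟩ := h.hyp.2 x y z g g₂ g₃ (hg.isGeodSegment h0 h1)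
        (hg₂.isGeodSegment h20 h21) (hg₃.isGeodSegment h30 h31) s hs
      exact hu.imp (fun hu => (Metric.infDist_le_dist_of_mem hu).trans hd)
        (fun hu => (Metric.infDist_le_dist_of_mem hu).trans hd))
    ⟨dist x y, by simp, by
      rw [mem_ofPred_eq, h1, Metric.infDist_zero_of_mem hy]; exact h.nonneg⟩
    ⟨0, by simp, by
      rw [mem_ofPred_eq, h0, Metric.infDist_zero_of_mem hx]; exact h.nonneg⟩
  obtain ⟨s, hs, hs2, hs3⟩ := hne
  obtain ⟨_, ⟨u, hu, rfl⟩, hd2⟩ := hS₂.exists_infDist_eq_dist ⟨y, hy⟩ (g s)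
  obtain ⟨_, ⟨v, hv, rfl⟩, hd3⟩ := hS₃.exists_infDist_eq_dist ⟨x, hx⟩ (g s)
  rw [mem_ofPred_eq, hd2] at hs2
  rw [mem_ofPred_eq, hd3] at hs3
  have e1 := hg₂.dist_eq 0 u
  have e2 := hg₂.dist_eq u (dist y z)
  have e3 := hg₃.dist_eq 0 v
  have e4 := hg₃.dist_eq v (dist z x)
  rw [h20, abs_of_nonpos (by linarith [hu.1])] at e1
  rw [h21, abs_of_nonpos (by linarith [hu.2])] at e2
  rw [h30, abs_of_nonpos (by linarith [hv.1])] at e3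
  rw [h31, abs_of_nonpos (by linarith [hv.2])] at e4
  refine ⟨s, hs.1, hs.2, ?_, ?_⟩
  · linarith [dist_triangle_right y (g s) (g₂ u), dist_triangle (g s) (g₂ u) z]
  · have t1 := dist_triangle_left x (g s) (g₃ v)
    have t2 := dist_triangle (g s) (g₃ v) z
    rw [dist_comm (g₃ v) (g s)] at t1
    rw [dist_comm (g₃ v) z] at t2
    rw [dist_comm x z]
    linarith

theorem four_point (h : IsHorofactor δ w a) (x y z v : H) :
    dist x y + dist z v ≤ max (dist x z + dist y v) (dist z y + dist x v) + 4 * δ := by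
  obtain ⟨g, hg, h0, h1⟩ := h.exists_line x y
  obtain ⟨g₂, hg₂, h20, h21⟩ := h.exists_line y z
  obtain ⟨g₃, hg₃, h30, h31⟩ := h.exists_line z x
  obtain ⟨s, hs0, hs1, c1, c2⟩ := h.exists_center x y v hg h0 h1
  have t0 := dist_triangle x (g s) y
  have t1 := dist_triangle_left z v (g s)
  have t2 := dist_comm y (g s)
  obtain ⟨_, ⟨u, hu, rfl⟩ | ⟨u, hu, rfl⟩, hd⟩ := h.hyp.2 x y z g g₂ g₃ (hg.isGeodSegment h0 h1)
    (hg₂.isGeodSegment h20 h21) (hg₃.isGeodSegment h30 h31) s ⟨hs0, hs1⟩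
  · have e1 := hg₂.dist_eq 0 u
    have e2 := hg₂.dist_eq u (dist y z)
    rw [h20, abs_of_nonpos (by linarith [hu.1])] at e1
    rw [h21, abs_of_nonpos (by linarith [hu.2])] at e2
    have := le_max_right (dist x z + dist y v) (dist z y + dist x v)
    rw [dist_comm z y] at this ⊢
    have t3 := dist_triangle (g s) (g₂ u) z
    have t4 := dist_triangle_right y (g s) (g₂ u)
    linarith
  · have e3 := hg₃.dist_eq 0 u
    have e4 := hg₃.dist_eq u (dist z x)
    rw [h30, abs_of_nonpos (by linarith [hu.1])] at e3
    rw [h31, abs_of_nonpos (by linarith [hu.2])] at e4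
    have := le_max_left (dist x z + dist y v) (dist z y + dist x v)
    rw [dist_comm x z] at this ⊢
    have t3 := dist_triangle_right (g s) z (g₃ u)
    have t4 := dist_triangle_right x (g s) (g₃ u)
    rw [dist_comm x (g₃ u)] at t4
    linarith

theorem height_ultra (h : IsHorofactor δ w a) (x y z : H) :
    (height w a x + height w a y + dist x y) / 2 ≤
      max ((height w a x + height w a z + dist x z) / 2)
        ((height w a z + height w a y + dist z y) / 2) + 2 * δ := by
  have key : dist x y - height w a z ≤
      max (dist x z - height w a y) (dist z y - height w a x) + 4 * δ := by
    refine le_of_tendsto_of_tendsto ((tendsto_const_nhds (x := dist x y)).sub (h.tendsto_height z))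
      ((((tendsto_const_nhds (x := dist x z)).sub (h.tendsto_height y)).max
      ((tendsto_const_nhds (x := dist z y)).sub (h.tendsto_height x))).add
      (tendsto_const_nhds (x := 4 * δ))) (Eventually.of_forall fun t => ?_)
    have := h.four_point x y z (a t)
    rcases max_cases (dist x z + dist y (a t)) (dist z y + dist x (a t)) with ⟨e, -⟩ | ⟨e, -⟩
    · rw [e] at this
      have := le_max_left (dist x z - (t - dist y (a t))) (dist z y - (t - dist x (a t)))
      dsimp only
      linarith
    · rw [e] at this
      have := le_max_right (dist x z - (t - dist y (a t))) (dist z y - (t - dist x (a t)))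
      dsimp only
      linarith
  rcases max_cases (dist x z - height w a y) (dist z y - height w a x) with ⟨e, -⟩ | ⟨e, -⟩
  · rw [e] at key
    have := le_max_left ((height w a x + height w a z + dist x z) / 2)
        ((height w a z + height w a y + dist z y) / 2)
    linarith
  · rw [e] at key
    have := le_max_right ((height w a x + height w a z + dist x z) / 2)
        ((height w a z + height w a y + dist z y) / 2)
    linarith

end IsHorofactor

theorem exists_limit_line [ProperSpace H] {g : ℕ → ℝ → H} (hg : ∀ n, IsGeodesicLine (g n))
    {x : H} {R : ℝ} (hx : ∀ᶠ n in (hyperfilter ℕ : Filter ℕ), dist x (g n 0) ≤ R) :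
    ∃ G : ℝ → H, IsGeodesicLine G ∧
      ∀ t, Tendsto (fun n => g n t) (hyperfilter ℕ : Filter ℕ) (𝓝 (G t)) := by
  have hlim : ∀ t, ∃ y, Tendsto (fun n => g n t) (hyperfilter ℕ : Filter ℕ) (𝓝 y) := by
    intro t
    obtain ⟨y, -, hy⟩ := (isCompact_closedBall x (R + |t|)).ultrafilter_le_nhds'
      ((hyperfilter ℕ).map fun n => g n t) (by
        rw [Ultrafilter.mem_map]
        filter_upwards [hx] with n hn
        have h1 := (hg n).dist_eq 0 t
        rw [zero_sub, abs_neg] at h1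
        rw [mem_preimage, Metric.mem_closedBall, dist_comm]
        linarith [dist_triangle x (g n 0) (g n t)])
    exact ⟨y, hy⟩
  choose G hG using hlim
  refine ⟨G, .of_dist_eq fun s t => ?_, hG⟩
  exact tendsto_nhds_unique ((hG s).dist (hG t))
    (tendsto_const_nhds.congr fun n => ((hg n).dist_eq s t).symm)

/-- A path which is locally close to geodesic lines is close to a limit of these lines. -/
theorem exists_limit_line_near [ProperSpace H] {g : ℕ → ℝ → H} (hg : ∀ n, IsGeodesicLine (g n))
    {c : ℝ → H} {κ : ℝ} (hc : ∀ t, ∀ᶠ n in atTop, ∃ s, dist (c t) (g n s) ≤ κ) :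
    ∃ (G : ℝ → H) (b : ℕ → ℝ), IsGeodesicLine G ∧
      (∀ s, Tendsto (fun n => g n (b n + s)) (hyperfilter ℕ : Filter ℕ) (𝓝 (G s))) ∧
      ∀ t, ∃ s, dist (c t) (G s) ≤ κ := by
  have hc' : ∀ t, ∃ σ : ℕ → ℝ, ∀ᶠ n in (hyperfilter ℕ : Filter ℕ), dist (c t) (g n (σ n)) ≤ κ :=
    fun t => Eventually.choice ((hc t).filter_mono Nat.hyperfilter_le_atTop)
  choose σ hσ using hc'
  obtain ⟨G, hG, hlim⟩ := exists_limit_line (g := fun n t => g n (σ 0 n + t))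
    (fun n => (hg n).comp_add _) (x := c 0) (R := κ) (by simpa using hσ 0)
  refine ⟨G, σ 0, hG, hlim, fun t => ?_⟩
  obtain ⟨r, -, hr⟩ := (isCompact_Icc (a := -(2 * κ + dist (c t) (c 0)))
    (b := 2 * κ + dist (c t) (c 0))).ultrafilter_le_nhds'
      ((hyperfilter ℕ).map fun n => σ t n - σ 0 n) (by
        rw [Ultrafilter.mem_map]
        filter_upwards [hσ 0, hσ t] with n h0 ht
        have h1 := (hg n).dist_eq (σ t n) (σ 0 n)
        have h2 := dist_triangle4 (g n (σ t n)) (c t) (c 0) (g n (σ 0 n))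
        rw [dist_comm (g n (σ t n)) (c t)] at h2
        rw [mem_preimage, mem_Icc, ← abs_le]
        linarith)
  have hr' : Tendsto (fun n => σ t n - σ 0 n) (hyperfilter ℕ : Filter ℕ) (𝓝 r) := hr
  refine ⟨r, ?_⟩
  have h1 : Tendsto (fun n => κ + |(σ t n - σ 0 n) - r|) (hyperfilter ℕ : Filter ℕ) (𝓝 κ) := by
    simpa using (tendsto_const_nhds (x := κ)).add (hr'.sub_const r).abs
  refine le_of_tendsto_of_tendsto ((tendsto_const_nhds (x := c t)).dist (hlim r)) h1 ?_
  filter_upwards [hσ t] with n hn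
  have h2 := (hg n).dist_eq (σ t n) (σ 0 n + r)
  rw [← sub_sub] at h2
  linarith [dist_triangle (c t) (g n (σ t n)) (g n (σ 0 n + r))]

namespace IsHorofactor

variable {δ : ℝ} {w : H} {a : ℝ → H}

/-- Through every point there is a vertical geodesic. -/
theorem exists_vertical [ProperSpace H] (h : IsHorofactor δ w a) (y : H) :
    ∃ V : ℝ → H, IsGeodesicLine V ∧ V 0 = y ∧ ∀ t, height w a (V t) = height w a y + t := by
  choose g hg h0 h1 using fun n : ℕ => h.exists_line y (a n)
  obtain ⟨V, hV, hlim⟩ := exists_limit_line hg (x := y) (R := 0)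
    (Eventually.of_forall fun n => by rw [h0, dist_self])
  refine ⟨V, hV, tendsto_nhds_unique (hlim 0) (tendsto_const_nhds.congr fun n => (h0 n).symm),
    fun t => ?_⟩
  have hn : Tendsto (fun n : ℕ => (n : ℝ)) (hyperfilter ℕ : Filter ℕ) atTop :=
    tendsto_natCast_atTop_atTop.mono_left Nat.hyperfilter_le_atTop
  have hy := (h.tendsto_height y).comp hn
  have hVt := (h.tendsto_height (V t)).comp hn
  have hdist : Tendsto (fun n => dist (g n t) (V t)) (hyperfilter ℕ : Filter ℕ) (𝓝 0) := by
    simpa using (hlim t).dist (tendsto_const_nhds (x := V t))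
  have hbig : ∀ᶠ n : ℕ in (hyperfilter ℕ : Filter ℕ), t ≤ dist y (a n) := by
    filter_upwards [hn.eventually_ge_atTop (t + dist y w), hn.eventually_ge_atTop 0] with n hn hn0
    have e1 := h.dist_ray le_rfl hn0
    rw [h.ray.2, zero_sub, abs_neg, abs_of_nonneg hn0] at e1
    linarith [dist_triangle_left w (a n) y]
  refine tendsto_nhds_unique hVt (tendsto_of_tendsto_of_dist (hy.add_const t) ?_)
  refine squeeze_zero' (Eventually.of_forall fun n => dist_nonneg) ?_ hdist
  filter_upwards [hbig] with n hn
  have e1 := (hg n).dist_eq t (dist y (a n))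
  rw [h1, abs_of_nonpos (by linarith)] at e1
  have e2 := abs_dist_sub_le (g n t) (V t) (a n)
  simp only [Function.comp_apply, Real.dist_eq]
  have e3 : (n : ℝ) - dist y (a n) + t - (n - dist (V t) (a n)) =
    -(dist (g n t) (a n) - dist (V t) (a n)) := by rw [e1]; ring
  rwa [e3, abs_neg]

/-- A path along which distances agree with the parameter up to a constant is close to a line. -/
theorem exists_line_near [ProperSpace H] (h : IsHorofactor δ w a) {c : ℝ → H} {K : ℝ}
    (hc : ∀ s t, |dist (c s) (c t) - abs (s - t)| ≤ K) :
    ∃ g : ℝ → H, IsGeodesicLine g ∧ ∀ t, ∃ s, dist (c t) (g s) ≤ (3 * K + 4 * δ) / 2 := by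
  choose g hg h0 h1 using fun n : ℕ => h.exists_line (c (-n)) (c n)
  obtain ⟨G, -, hG, -, hnear⟩ := exists_limit_line_near hg (c := c) (κ := (3 * K + 4 * δ) / 2)
    (fun t => by
      filter_upwards [tendsto_natCast_atTop_atTop.eventually_ge_atTop (|t|)] with n hn
      obtain ⟨s, hs0, hs1, e1, e2⟩ := h.exists_center _ _ (c t) (hg n) (h0 n) (h1 n)
      refine ⟨s, ?_⟩
      have l1 := (abs_le.1 (hc (-n) n)).1
      have l2 := (abs_le.1 (hc n t)).2
      have l3 := (abs_le.1 (hc (-n) t)).2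
      have b := abs_le.1 hn
      rw [abs_of_nonpos (by linarith)] at l1 l3
      rw [abs_of_nonneg (by linarith)] at l2
      have t1 := dist_triangle_right (c (-n)) (c n) (g n s)
      rw [dist_comm (c t)]
      linarith)
  exact ⟨G, hG, hnear⟩

/-- A path along which distances agree with height differences up to a constant is close to a
vertical geodesic. -/
theorem exists_vertical_near [ProperSpace H] (h : IsHorofactor δ w a) {c : ℝ → H} {K : ℝ}
    (hc : ∀ s t, dist (c s) (c t) ≤ |height w a (c s) - height w a (c t)| + K) :
    ∃ v : ℝ → H, IsVerticalGeodesicLine w a v ∧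
      ∀ t, ∃ s, dist (c t) (v s) ≤ 2 + K + 4 * δ := by
  obtain ⟨τ, hτ⟩ : ∃ τ : ℕ → ℝ, ∀ t, ∀ᶠ n in atTop,
      height w a (c (τ n)) ≤ height w a (c t) + 1 := by
    by_cases hb : BddBelow (range fun t => height w a (c t))
    · obtain ⟨_, ⟨t₀, rfl⟩, ht₀⟩ := Real.lt_sInf_add_pos (range_nonempty fun t => height w a (c t))
        one_pos
      refine ⟨fun _ => t₀, fun t => Eventually.of_forall fun n => ?_⟩
      have := csInf_le hb (mem_range_self t)
      linarith
    · have : ∀ n : ℕ, ∃ t, height w a (c t) < -n := by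
        intro n
        by_contra! hcon
        exact hb ⟨-n, by rintro _ ⟨t, rfl⟩; exact hcon t⟩
      choose τ hτ using this
      refine ⟨τ, fun t => ?_⟩
      filter_upwards [tendsto_natCast_atTop_atTop.eventually_ge_atTop (-height w a (c t))] with n hn
      linarith [hτ n]
  choose V hV h0 hheight using fun n => h.exists_vertical (c (τ n))
  obtain ⟨G, b, hG, hlim, hnear⟩ := exists_limit_line_near hV (c := c) (κ := 2 + K + 4 * δ)
    (fun t => by
      filter_upwards [hτ t] with n hn
      refine ⟨height w a (c t) - height w a (c (τ n)), ?_⟩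
      set m := V n (height w a (c t) - height w a (c (τ n))) with hm
      have hhm : height w a m = height w a (c t) := by rw [hm, hheight]; ring
      have hdm : dist (c (τ n)) m = |height w a (c t) - height w a (c (τ n))| := by
        rw [hm, ← h0 n, (hV n).dist_eq, zero_sub, abs_neg, h0 n]
      have e1 := h.height_ultra (c t) m (c (τ n))
      have e2 := hc t (τ n)
      have e3 : |height w a (c t) - height w a (c (τ n))| ≤
          height w a (c t) - height w a (c (τ n)) + 2 := by
        rw [abs_le]; constructor <;> linarith
      have hK : 0 ≤ K := by simpa using hc t t
      rw [hhm, hdm] at e1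
      have := max_le (a := (height w a (c t) + height w a (c (τ n)) + dist (c t) (c (τ n))) / 2)
        (b := (height w a (c (τ n)) + height w a (c t) +
          |height w a (c t) - height w a (c (τ n))|) / 2)
        (c := height w a (c t) + 1 + K / 2) (by linarith) (by linarith)
      linarith)
  refine ⟨G, ⟨hG, Or.inl ?_⟩, hnear⟩
  have hGh : ∀ s, height w a (G s) = height w a (G 0) + s := by
    intro s
    have hl : ∀ s, Tendsto (fun n => height w a (V n (b n + s))) (hyperfilter ℕ : Filter ℕ)
        (𝓝 (height w a (G s))) := fun s => (h.continuous_height.tendsto _).comp (hlim s)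
    refine tendsto_nhds_unique (hl s) (((hl 0).add_const s).congr fun n => ?_)
    rw [hheight, hheight]; ring
  exact (tendsto_atTop_add_const_left _ _ tendsto_id).congr fun s => (hGh s).symm

end IsHorofactor

namespace AdmNorm

variable (N : AdmNorm)

theorem apply_le_add (a b a' b' : ℝ) :
    N.toFun (a, b) ≤ N.toFun (a', b') + N.toFun (1, 0) * |a - a'| + N.toFun (0, 1) * |b - b'| := by
  have e : ((a, b) : ℝ × ℝ) =
      (a', b') + ((a - a') • ((1 : ℝ), (0 : ℝ)) + (b - b') • ((0 : ℝ), (1 : ℝ))) := by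
    ext <;> simp
  have h1 := N.add_le (a', b') ((a - a') • ((1 : ℝ), (0 : ℝ)) + (b - b') • ((0 : ℝ), (1 : ℝ)))
  have h2 := N.add_le ((a - a') • ((1 : ℝ), (0 : ℝ))) ((b - b') • ((0 : ℝ), (1 : ℝ)))
  rw [N.smul_eq, N.smul_eq] at h2
  rw [← e] at h1
  linarith

theorem apply_zero : N.toFun (0, 0) = 0 := (N.eq_zero_iff _).2 rfl

theorem apply_mul_one_one (b : ℝ) : N.toFun (b, b) = |b| := by
  simpa [N.one_one] using N.smul_eq b (1, 1)

theorem half_le_left : 1 / 2 ≤ N.toFun (1, 0) := by simpa using N.adm 1 0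

theorem half_le_right : 1 / 2 ≤ N.toFun (0, 1) := by simpa using N.adm 0 1

theorem one_le_add : 1 ≤ N.toFun (1, 0) + N.toFun (0, 1) := by
  simpa [N.one_one, N.apply_zero] using N.apply_le_add 1 1 0 0

theorem left_mul_sub_le (a b : ℝ) :
    N.toFun (1, 0) * |a| - N.toFun (0, 1) * |b| ≤ N.toFun (a, b) := by
  have h1 := N.apply_le_add a 0 a b
  have h2 : N.toFun (a, 0) = |a| * N.toFun (1, 0) := by
    simpa using N.smul_eq a (1, 0)
  rw [h2] at h1
  simp only [sub_self, abs_zero, mul_zero, zero_sub, abs_neg] at h1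
  linarith

theorem right_mul_sub_le (a b : ℝ) :
    N.toFun (0, 1) * |b| - N.toFun (1, 0) * |a| ≤ N.toFun (a, b) := by
  have h1 := N.apply_le_add 0 b a b
  have h2 : N.toFun (0, b) = |b| * N.toFun (0, 1) := by
    simpa using N.smul_eq b (0, 1)
  rw [h2] at h1
  simp only [sub_self, abs_zero, mul_zero, zero_sub, abs_neg] at h1
  linarith

theorem apply_le_left {a b : ℝ} (hb : 0 ≤ b) (hab : b ≤ a) :
    N.toFun (a, b) ≤ b + N.toFun (1, 0) * (a - b) := by
  have := N.apply_le_add a b b b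
  rw [N.apply_mul_one_one, abs_of_nonneg hb, abs_of_nonneg (sub_nonneg.2 hab)] at this
  simpa using this

theorem apply_le_right {a b : ℝ} (ha : 0 ≤ a) (hab : a ≤ b) :
    N.toFun (a, b) ≤ a + N.toFun (0, 1) * (b - a) := by
  have := N.apply_le_add a b a a
  rw [N.apply_mul_one_one, abs_of_nonneg ha, abs_of_nonneg (sub_nonneg.2 hab)] at this
  simpa using this

/-- `A` and `B` bound the `N`-cost of horizontal moves in the two factors. -/
def PathConst (A B : ℝ) : Prop :=
  1 ≤ A ∧ 1 ≤ B ∧ ∀ a b a₁ b₁ r : ℝ, 0 ≤ a → 0 ≤ b → 0 ≤ a₁ → a₁ ≤ b₁ → |a - a₁| ≤ r →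
    |b - b₁| ≤ r → N.toFun (a, b) ≤ a₁ + B * (b₁ - a₁) + A * r

theorem exists_pathConst (h : N.toFun (0, 1) ≤ 1 ∨ 1 < N.toFun (1, 0)) :
    ∃ A B, N.PathConst A B ∧ (A = 1 ∨ 1 < N.toFun (1, 0)) ∧ (B = 1 ∨ 1 < N.toFun (0, 1)) := by
  by_cases h0 : N.toFun (1, 0) ≤ 1 ∧ N.toFun (0, 1) ≤ 1
  · refine ⟨1, 1, ⟨le_rfl, le_rfl, fun a b a₁ b₁ r ha hb ha₁ hab h1 h2 => ?_⟩, Or.inl rfl,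
      Or.inl rfl⟩
    have h1 := (abs_le.1 h1).2
    have h2 := (abs_le.1 h2).2
    rcases le_total a b with hle | hle
    · have := N.apply_le_right ha hle
      nlinarith
    · have := N.apply_le_left hb hle
      nlinarith
  · have h0' : 1 < N.toFun (1, 0) := by
      by_contra! hcon
      exact h0 ⟨hcon, h.resolve_right (not_lt.2 hcon)⟩
    refine ⟨N.toFun (1, 0) + N.toFun (0, 1), max 1 (N.toFun (0, 1)),
      ⟨N.one_le_add, le_max_left _ _, fun a b a₁ b₁ r ha hb ha₁ hab h1 h2 => ?_⟩, Or.inr h0', ?_⟩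
    · have e1 := N.apply_le_add a b a₁ b₁
      have e2 := N.apply_le_right ha₁ hab
      have e3 := mul_le_mul_of_nonneg_left h1 (by linarith [N.half_le_left] : 0 ≤ N.toFun (1, 0))
      have e4 := mul_le_mul_of_nonneg_left h2 (by linarith [N.half_le_right] : 0 ≤ N.toFun (0, 1))
      have e5 := mul_le_mul_of_nonneg_right (le_max_right 1 (N.toFun (0, 1))) (sub_nonneg.2 hab)
      linarith
    · rcases le_or_gt (N.toFun (0, 1)) 1 with hle | hlt
      · exact Or.inl (max_eq_left hle)
      · exact Or.inr hlt

/-- The norm with the two coordinates exchanged. -/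
def swap : AdmNorm where
  toFun v := N.toFun v.swap
  eq_zero_iff v := by rw [N.eq_zero_iff, Prod.swap_eq_iff_eq_swap]; rfl
  smul_eq c v := by rw [← N.smul_eq, Prod.smul_swap]
  add_le v w := by rw [Prod.swap_add]; exact N.add_le _ _
  one_one := N.one_one
  adm a b := by rw [add_comm]; exact N.adm b a

end AdmNorm

theorem ofReal_le_dHN (Nf : ℝ × ℝ → ℝ) (mem : Hp × Hq → Prop) (x y : Hp × Hq) :
    ENNReal.ofReal (Nf (dist y.1 x.1, dist y.2 x.2)) ≤ dHN Nf mem x y := by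
  refine le_iInf fun T => le_iInf fun hT => le_iInf fun γ => le_iInf fun _ => le_iInf fun _ =>
    le_iInf fun h0 => le_iInf fun h1 => ?_
  refine le_iSup_of_le (⟨1, fun i => if i = 0 then 0 else T, ?_, ?_⟩ :
    ℕ × { u : ℕ → ℝ // Monotone u ∧ ∀ i, u i ∈ Icc 0 T }) ?_
  · refine monotone_nat_of_le_succ fun n => ?_
    by_cases hn : n = 0 <;> simp [hn, hT]
  · intro i
    by_cases hi : i = 0 <;> simp [hi, hT]
  · simp [h0, h1]

theorem dHN_le_ofReal {Nf : ℝ × ℝ → ℝ} {mem : Hp × Hq → Prop} {x y : Hp × Hq} {T : ℝ} (hT : 0 ≤ T)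
    {γ : ℝ → Hp × Hq} (hγ : Continuous γ) (hmem : ∀ t, mem (γ t)) (h0 : γ 0 = x) (h1 : γ T = y)
    {F : ℝ → ℝ} (hF : ∀ u v, 0 ≤ u → u ≤ v → v ≤ T → 0 ≤ F v - F u ∧
      Nf (dist (γ v).1 (γ u).1, dist (γ v).2 (γ u).2) ≤ F v - F u) :
    dHN Nf mem x y ≤ ENNReal.ofReal (F T - F 0) := by
  refine iInf_le_of_le T <| iInf_le_of_le hT <| iInf_le_of_le γ <| iInf_le_of_le hγ.continuousOn <|
    iInf_le_of_le (fun t _ => hmem t) <| iInf_le_of_le h0 <| iInf_le_of_le h1 <| iSup_le ?_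
  rintro ⟨n, u, hu, hmem⟩
  have hstep : ∀ i, 0 ≤ F (u (i + 1)) - F (u i) ∧ Nf (dist (γ (u (i + 1))).1 (γ (u i)).1,
      dist (γ (u (i + 1))).2 (γ (u i)).2) ≤ F (u (i + 1)) - F (u i) := fun i =>
    hF _ _ (hmem i).1 (hu (Nat.le_succ i)) (hmem (i + 1)).2
  calc _ ≤ ∑ i ∈ Finset.range n, ENNReal.ofReal (F (u (i + 1)) - F (u i)) :=
        Finset.sum_le_sum fun i _ => ENNReal.ofReal_le_ofReal (hstep i).2
    _ = ENNReal.ofReal (∑ i ∈ Finset.range n, (F (u (i + 1)) - F (u i))) :=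
        (ENNReal.ofReal_sum_of_nonneg fun i _ => (hstep i).1).symm
    _ ≤ ENNReal.ofReal (F T - F 0) := by
        rw [Finset.sum_range_sub (fun i => F (u i))]
        refine ENNReal.ofReal_le_ofReal ?_
        have e1 := (hF 0 (u 0) le_rfl (hmem 0).1 (hmem 0).2).1
        have e2 := (hF (u n) T (hmem n).1 (hmem n).2 le_rfl).1
        linarith

theorem dHN_swap (Nf : ℝ × ℝ → ℝ) (mem : Hp × Hq → Prop) (x y : Hp × Hq) :
    dHN (fun v => Nf v.swap) (fun z : Hq × Hp => mem z.swap) x.swap y.swap ≤ dHN Nf mem x y := by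
  refine le_iInf fun T => le_iInf fun hT => le_iInf fun γ => le_iInf fun hγ => le_iInf fun hm =>
    le_iInf fun h0 => le_iInf fun h1 => ?_
  refine iInf_le_of_le T <| iInf_le_of_le hT <| iInf_le_of_le (fun t => (γ t).swap) <|
    iInf_le_of_le (continuous_swap.comp_continuousOn hγ) <|
    iInf_le_of_le (fun t ht => by simpa using hm t ht) <| iInf_le_of_le (by simp [h0]) <|
    iInf_le_of_le (by simp [h1]) le_rfl

theorem IsHNGeodesicOn.swap {Nf : ℝ × ℝ → ℝ} {wp : Hp} {ap : ℝ → Hp} {wq : Hq} {aq : ℝ → Hq}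
    {α : ℝ → Hp × Hq} {I : Set ℝ} (h : IsHNGeodesicOn Nf (inHoro wp ap wq aq) α I) :
    IsHNGeodesicOn (fun v => Nf v.swap) (inHoro wq aq wp ap) (fun t => (α t).swap) I := by
  have hmem : inHoro wq aq wp ap = fun z : Hq × Hp => inHoro wp ap wq aq z.swap := by
    funext z
    simp [inHoro, add_comm]
  refine ⟨fun t ht => by rw [hmem]; simpa using h.1 t ht, fun s hs t ht => ?_⟩
  rw [← h.2 s hs t ht, hmem]
  refine le_antisymm (dHN_swap _ _ _ _) ?_
  simpa using dHN_swap (fun v => Nf v.swap) (fun z : Hq × Hp => inHoro wp ap wq aq z.swap)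
    (α s).swap (α t).swap

/-- Length of an explicit path: a geodesic in the second factor followed by one in the first,
the other factor moving vertically. -/
theorem dHN_le_of_height_le [ProperSpace Hp] [ProperSpace Hq] {N : AdmNorm} {A B : ℝ}
    (hAB : N.PathConst A B) {δ : ℝ} {wp : Hp} {ap : ℝ → Hp} {wq : Hq} {aq : ℝ → Hq}
    (hp : IsHorofactor δ wp ap) (hq : IsHorofactor δ wq aq) {x y : Hp × Hq}
    (hx : inHoro wp ap wq aq x) (hy : inHoro wp ap wq aq y)
    (hxy : height wp ap x.1 ≤ height wp ap y.1) :
    dHN N.toFun (inHoro wp ap wq aq) x y ≤ ENNReal.ofReal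
      ((height wp ap y.1 - height wp ap x.1) +
        A * (dist x.1 y.1 - (height wp ap y.1 - height wp ap x.1) + 4 * δ) +
        B * (dist x.2 y.2 - (height wp ap y.1 - height wp ap x.1))) := by
  obtain ⟨hA, hB, hN⟩ := hAB
  unfold inHoro at hx hy
  obtain ⟨g₁, hg₁, g₁0, g₁1⟩ := hq.exists_line x.2 y.2
  obtain ⟨V, hV, V0, hVh⟩ := hp.exists_vertical x.1
  obtain ⟨W, hW, W0, hWh⟩ := hq.exists_vertical y.2
  set z := V (height wq aq x.2 - height wq aq y.2) with hz
  have hzh : height wp ap z = height wp ap y.1 := by rw [hz, hVh]; linarith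
  obtain ⟨g₂, hg₂, g₂0, g₂1⟩ := hp.exists_line z y.1
  set j := dist x.2 y.2 with hj
  set l := dist z y.1 with hl
  have hj0 : 0 ≤ j := dist_nonneg
  have hl0 : 0 ≤ l := dist_nonneg
  have hl_le : l ≤ dist x.1 y.1 - (height wp ap y.1 - height wp ap x.1) + 4 * δ := by
    have e1 := hp.height_ultra z y.1 x.1
    have e2 : dist z x.1 = height wp ap y.1 - height wp ap x.1 := by
      rw [hz, ← V0, hV.dist_eq, sub_zero, V0, abs_of_nonneg (by linarith)]; linarith
    have e3 := hp.height_sub_le y.1 x.1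
    rw [dist_comm] at e3
    rw [max_eq_right (by linarith), ← hl] at e1
    linarith
  set γ₁ : ℝ → Hp × Hq := fun t => (V (height wq aq x.2 - height wq aq (g₁ t)), g₁ t) with hγ₁
  set γ₂ : ℝ → Hp × Hq := fun t =>
    (g₂ (t - j), W (height wp ap y.1 - height wp ap (g₂ (t - j)))) with hγ₂
  have hγ₁c : Continuous γ₁ :=
    (hV.continuous.comp (continuous_const.sub (hq.continuous_height.comp hg₁.continuous))).prodMk
      hg₁.continuous
  have hg₂c : Continuous fun t => g₂ (t - j) := hg₂.continuous.comp (continuous_id.sub continuous_const)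
  have hγ₂c : Continuous γ₂ := hg₂c.prodMk
    (hW.continuous.comp (continuous_const.sub (hp.continuous_height.comp hg₂c)))
  have hjunction : γ₁ j = γ₂ j := by
    simp only [hγ₁, hγ₂, g₁1, sub_self, g₂0, hzh, W0, ← hz]
  have d₁ : ∀ u v, u ≤ v → dist (γ₁ v).2 (γ₁ u).2 = v - u ∧
      dist (γ₁ v).1 (γ₁ u).1 = |height wq aq (g₁ u) - height wq aq (g₁ v)| ∧
      |height wq aq (g₁ u) - height wq aq (g₁ v)| ≤ v - u := fun u v huv => by
    refine ⟨?_, ?_, ?_⟩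
    · rw [hg₁.dist_eq, abs_of_nonneg (by linarith)]
    · rw [hV.dist_eq]; congr 1; ring
    · refine (hq.abs_height_sub_le _ _).trans ?_
      rw [hg₁.dist_eq, abs_of_nonpos (by linarith)]; linarith
  have d₂ : ∀ u v, u ≤ v → dist (γ₂ v).1 (γ₂ u).1 ≤ v - u ∧ dist (γ₂ v).2 (γ₂ u).2 ≤ v - u :=
      fun u v huv => by
    have e1 : dist (g₂ (u - j)) (g₂ (v - j)) = v - u := by
      rw [hg₂.dist_eq, abs_of_nonpos (by linarith)]; ring
    refine ⟨?_, ?_⟩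
    · rw [dist_comm]; exact e1.le
    · rw [hW.dist_eq, ← e1]
      convert hp.abs_height_sub_le (g₂ (u - j)) (g₂ (v - j)) using 2
      ring
  set F₁ : ℝ → ℝ := fun t => B * t + (B - 1) * height wq aq (g₁ t) with hF₁
  have hF₁' : ∀ u v, u ≤ v → |height wq aq (g₁ u) - height wq aq (g₁ v)| +
      B * ((v - u) - |height wq aq (g₁ u) - height wq aq (g₁ v)|) ≤ F₁ v - F₁ u := fun u v huv => by
    have e1 := le_abs_self (height wq aq (g₁ u) - height wq aq (g₁ v))
    have e2 := mul_le_mul_of_nonneg_left e1 (sub_nonneg.2 hB)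
    simp only [hF₁]
    linarith
  have hF₁mono : ∀ u v, u ≤ v → 0 ≤ F₁ v - F₁ u := fun u v huv => by
    refine le_trans ?_ (hF₁' u v huv)
    have := mul_nonneg (by linarith : 0 ≤ B) (sub_nonneg.2 (d₁ u v huv).2.2)
    positivity
  have key := dHN_le_ofReal (Nf := N.toFun) (mem := inHoro wp ap wq aq) (x := x) (y := y)
    (add_nonneg hj0 hl0) (γ := fun t => if t ≤ j then γ₁ t else γ₂ t)
    (Continuous.if_le hγ₁c hγ₂c continuous_id continuous_const (by rintro t rfl; exact hjunction))
    (fun t => by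
      split_ifs
      · simp only [inHoro, hγ₁, hVh]; linarith
      · simp only [inHoro, hγ₂, hWh]; linarith)
    (by rw [if_pos hj0]; simp [hγ₁, g₁0, V0])
    (by
      split_ifs with hle
      · have hl00 : l = 0 := le_antisymm (by linarith) hl0
        rw [hl00, add_zero, hjunction]
        have : z = y.1 := dist_eq_zero.1 hl00
        simp [hγ₂, g₂0, W0, this]
      · simp [hγ₂, g₂1, W0])
    (F := fun t => F₁ (min t j) + A * (max t j - j))
    (fun u v _ huv _ => by
      have hmono : 0 ≤ max v j - max u j := sub_nonneg.2 (max_le_max_right j huv)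
      have hA0 := mul_nonneg (by linarith : 0 ≤ A) hmono
      refine ⟨?_, ?_⟩
      · have := hF₁mono _ _ (min_le_min_right j huv)
        linarith
      · by_cases hv : v ≤ j
        · have hu : u ≤ j := huv.trans hv
          obtain ⟨e1, e2, e3⟩ := d₁ u v huv
          simp only [hu, hv, if_true, min_eq_left, max_eq_right]
          rw [e1, e2]
          have := hN |height wq aq (g₁ u) - height wq aq (g₁ v)| (v - u)
            |height wq aq (g₁ u) - height wq aq (g₁ v)| (v - u) 0 (abs_nonneg _) (by linarith)
            (abs_nonneg _) e3 (by simp) (by simp)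
          linarith [hF₁' u v huv]
        by_cases hu : u ≤ j
        · simp only [hu, hv, if_true, if_false, min_eq_left, max_eq_right,
            min_eq_right (le_of_not_ge hv), max_eq_left (le_of_not_ge hv)]
          obtain ⟨e1, e2, e3⟩ := d₁ u j hu
          obtain ⟨e4, e5⟩ := d₂ j v (le_of_not_ge hv)
          rw [← hjunction] at e4 e5
          have := hN (dist (γ₂ v).1 (γ₁ u).1) (dist (γ₂ v).2 (γ₁ u).2) _ _ (v - j) dist_nonneg
            dist_nonneg (abs_nonneg _) e3
            (by rw [← e2]; exact (abs_dist_sub_le _ _ _).trans e4)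
            (by rw [← e1]; exact (abs_dist_sub_le _ _ _).trans e5)
          linarith [hF₁' u j hu]
        · simp only [hu, hv, if_false, min_eq_right (le_of_not_ge hu), max_eq_left (le_of_not_ge hu),
            min_eq_right (le_of_not_ge hv), max_eq_left (le_of_not_ge hv)]
          obtain ⟨e4, e5⟩ := d₂ u v huv
          have := hN (dist (γ₂ v).1 (γ₂ u).1) (dist (γ₂ v).2 (γ₂ u).2) 0 0 (v - u) dist_nonneg
            dist_nonneg le_rfl le_rfl (by simpa using e4) (by simpa using e5)
          linarith)
  refine key.trans (ENNReal.ofReal_le_ofReal ?_)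
  have e1 := mul_le_mul_of_nonneg_left hl_le (by linarith : 0 ≤ A)
  simp only [hF₁, min_eq_right (le_add_of_nonneg_right hl0 : j ≤ j + l),
    max_eq_left (le_add_of_nonneg_right hl0 : j ≤ j + l), min_eq_left hj0, max_eq_right hj0,
    g₁0, g₁1]
  have e2 : height wq aq x.2 = -height wp ap x.1 := by linarith
  have e3 : height wq aq y.2 = -height wp ap y.1 := by linarith
  rw [e2, e3]
  linarith

theorem productKernel_of_geodesic [ProperSpace Hp] [ProperSpace Hq] {N : AdmNorm} {A B : ℝ}
    (hAB : N.PathConst A B) {δ : ℝ} {wp : Hp} {ap : ℝ → Hp} {wq : Hq} {aq : ℝ → Hq}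
    (hp : IsHorofactor δ wp ap) (hq : IsHorofactor δ wq aq) {α : ℝ → Hp × Hq}
    (hα : IsHNGeodesicOn N.toFun (inHoro wp ap wq aq) α univ) :
    ProductKernel (fun t => height wp ap (α t).1)
      (fun s t => (height wp ap (α s).1 + height wp ap (α t).1 + dist (α s).1 (α t).1) / 2)
      (fun s t => (-height wp ap (α s).1 - height wp ap (α t).1 + dist (α s).2 (α t).2) / 2)
      (2 * δ) (N.toFun (1, 0)) (N.toFun (0, 1)) A B (A * (4 * δ)) := by
  have hδ := hp.nonneg
  have hmem : ∀ t, height wq aq (α t).2 = -height wp ap (α t).1 := fun t => by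
    have := hα.1 t trivial
    unfold inHoro at this
    linarith
  have hNle : ∀ s t, N.toFun (dist (α s).1 (α t).1, dist (α s).2 (α t).2) ≤ |s - t| := by
    intro s t
    have := ofReal_le_dHN N.toFun (inHoro wp ap wq aq) (α t) (α s)
    rwa [hα.2 t trivial s trivial, ENNReal.ofReal_le_ofReal_iff (abs_nonneg _), abs_sub_comm t]
      at this
  have hsum : ∀ s t, dist (α s).1 (α t).1 + dist (α s).2 (α t).2 ≤ 2 * |s - t| := fun s t => by
    linarith [hNle s t, N.adm (dist (α s).1 (α t).1) (dist (α s).2 (α t).2)]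
  have hc1 : Continuous fun t => (α t).1 := (LipschitzWith.of_dist_le_mul (K := 2) fun s t => by
    rw [Real.dist_eq]
    have := hsum s t
    push_cast
    linarith [dist_nonneg (x := (α s).2) (y := (α t).2)]).continuous
  have hc2 : Continuous fun t => (α t).2 := (LipschitzWith.of_dist_le_mul (K := 2) fun s t => by
    rw [Real.dist_eq]
    have := hsum s t
    push_cast
    linarith [dist_nonneg (x := (α s).1) (y := (α t).1)]).continuous
  have hcf : Continuous fun t => height wp ap (α t).1 := hp.continuous_height.comp hc1
  have hp1 : ∀ s t, |height wp ap (α s).1 - height wp ap (α t).1| ≤ dist (α s).1 (α t).1 :=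
    fun s t => hp.abs_height_sub_le _ _
  have hq1 : ∀ s t, |height wp ap (α s).1 - height wp ap (α t).1| ≤ dist (α s).2 (α t).2 :=
    fun s t => by
      have := hq.abs_height_sub_le (α s).2 (α t).2
      rwa [hmem, hmem, neg_sub_neg, abs_sub_comm] at this
  have hup : ∀ s t, height wp ap (α s).1 ≤ height wp ap (α t).1 → |s - t| ≤
      (height wp ap (α t).1 - height wp ap (α s).1) +
        A * (dist (α s).1 (α t).1 - (height wp ap (α t).1 - height wp ap (α s).1) + 4 * δ) +
        B * (dist (α s).2 (α t).2 - (height wp ap (α t).1 - height wp ap (α s).1)) := by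
    intro s t hst
    have := dHN_le_of_height_le hAB hp hq (hα.1 s trivial) (hα.1 t trivial) hst
    rw [hα.2 s trivial t trivial, ENNReal.ofReal_le_ofReal_iff'] at this
    refine this.elim id fun h0 => h0.trans ?_
    have e1 := (abs_le.1 (hp1 s t)).1
    have e2 := (abs_le.1 (hq1 s t)).1
    have e3 := mul_nonneg (by linarith [hAB.1] : 0 ≤ A) (by linarith : 0 ≤ dist (α s).1 (α t).1 -
      (height wp ap (α t).1 - height wp ap (α s).1) + 4 * δ)
    have e4 := mul_nonneg (by linarith [hAB.2.1] : 0 ≤ B) (by linarith : 0 ≤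
      dist (α s).2 (α t).2 - (height wp ap (α t).1 - height wp ap (α s).1))
    linarith
  have hlower := fun s t => N.left_mul_sub_le (dist (α s).1 (α t).1) (dist (α s).2 (α t).2)
  have hlower' := fun s t => N.right_mul_sub_le (dist (α s).1 (α t).1) (dist (α s).2 (α t).2)
  simp only [abs_of_nonneg dist_nonneg] at hlower hlower'
  refine ⟨⟨by positivity, ?_, ?_, ?_, ?_, ?_⟩, ⟨by positivity, ?_, ?_, ?_, ?_, ?_⟩, ?_, ?_, ?_⟩
  · intro s t; rw [dist_comm]; ring
  · intro s t u; exact hp.height_ultra _ _ _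
  · intro s t; linarith [(abs_le.1 (hp1 s t)).2]
  · intro s t; linarith [hsum s t, (abs_le.1 (hq1 s t)).1]
  · intro s; fun_prop
  · intro s t; rw [dist_comm]; ring
  · intro s t u
    have := hq.height_ultra (α s).2 (α u).2 (α t).2
    simpa only [hmem, ← sub_eq_add_neg] using this
  · intro s t; linarith [(abs_le.1 (hq1 s t)).1]
  · intro s t; linarith [hsum s t, (abs_le.1 (hp1 s t)).2]
  · intro s; fun_prop
  · intro s t; linarith [hlower s t, hNle s t]
  · intro s t; linarith [hlower' s t, hNle s t]
  · intro s t
    rcases le_total (height wp ap (α s).1) (height wp ap (α t).1) with hle | hle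
    · rw [abs_of_nonpos (sub_nonpos.2 hle)]
      linarith [hup s t hle]
    · rw [abs_of_nonneg (sub_nonneg.2 hle)]
      have := hup t s hle
      rw [abs_sub_comm, dist_comm (α t).1, dist_comm (α t).2] at this
      linarith

theorem exists_type_bound (δ : ℝ) (hδ : 0 ≤ δ) (N : AdmNorm)
    (hN : N.toFun (0, 1) ≤ 1 ∨ 1 < N.toFun (1, 0)) :
    ∃ κ : ℝ, 0 ≤ κ ∧ ∀ (Hp Hq : Type) [MetricSpace Hp] [MetricSpace Hq] [ProperSpace Hp]
      [ProperSpace Hq] (wp : Hp) (ap : ℝ → Hp) (wq : Hq) (aq : ℝ → Hq),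
      IsHorofactor δ wp ap → IsHorofactor δ wq aq → ∀ α : ℝ → Hp × Hq,
      IsHNGeodesicOn N.toFun (inHoro wp ap wq aq) α univ →
        IsHpType wq aq κ α ∨ IsHqType wp ap κ α := by
  obtain ⟨A, B, hAB, hA', hB'⟩ := N.exists_pathConst hN
  have hA := hAB.1
  obtain ⟨K, hK, hdich⟩ := ProductKernel.exists_dichotomy_bound (2 * δ) (N.toFun (1, 0))
    (N.toFun (0, 1)) A B (A * (4 * δ)) (by linarith [N.half_le_left])
    (by linarith [N.half_le_right]) hA hAB.2.1 (by positivity) hA' hB'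
  refine ⟨2 + 2 * K + 4 * δ, by positivity, fun Hp Hq _ _ _ _ wp ap wq aq hp hq α hα => ?_⟩
  have hmem : ∀ t, height wq aq (α t).2 = -height wp ap (α t).1 := fun t => by
    have := hα.1 t trivial
    unfold inHoro at this
    linarith
  rcases hdich _ _ _ (productKernel_of_geodesic hAB hp hq hα) with h | h
  · obtain ⟨g, hg, hgn⟩ := hp.exists_line_near (c := fun t => (α t).1) (K := K) fun s t => by
      convert (h s t).2 using 2; ring
    obtain ⟨v, hv, hvn⟩ := hq.exists_vertical_near (c := fun t => (α t).2) (K := K) fun s t => by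
      rw [hmem, hmem, neg_sub_neg, abs_sub_comm]
      linarith [(h s t).1]
    exact Or.inl ⟨⟨g, hg, fun t => (hgn t).imp fun s hs => by linarith⟩,
      ⟨v, hv, fun t => (hvn t).imp fun s hs => by linarith⟩⟩
  · obtain ⟨g, hg, hgn⟩ := hq.exists_line_near (c := fun t => (α t).2) (K := K) fun s t => by
      convert (h s t).2 using 2; ring
    obtain ⟨v, hv, hvn⟩ := hp.exists_vertical_near (c := fun t => (α t).1) (K := K) fun s t => by
      linarith [(h s t).1]
    exact Or.inr ⟨⟨g, hg, fun t => (hgn t).imp fun s hs => by linarith⟩,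
      ⟨v, hv, fun t => (hvn t).imp fun s hs => by linarith⟩⟩

end

/-- There is a constant `κ ≥ 0` depending only on `δ` and `N` such
that every geodesic line of any horospherical product of proper, geodesically
complete, δ-hyperbolic Busemann spaces is of `H_p`-type or `H_q`-type at scale `κ`. -/
theorem statement18 (δ : ℝ) (hδ : 1 ≤ δ) (N : AdmNorm) :
    ∃ κ : ℝ, 0 ≤ κ ∧
      ∀ (Hp Hq : Type) [MetricSpace Hp] [MetricSpace Hq],
        ∀ (_ : ProperSpace Hp) (_ : ProperSpace Hq)
          (_ : DeltaHyperbolic Hp δ) (_ : DeltaHyperbolic Hq δ)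
          (_ : BusemannSpace Hp) (_ : BusemannSpace Hq)
          (_ : GeodesicallyComplete Hp) (_ : GeodesicallyComplete Hq)
          (wp : Hp) (ap : ℝ → Hp) (_ : IsRayFrom wp ap)
          (wq : Hq) (aq : ℝ → Hq) (_ : IsRayFrom wq aq)
          (α : ℝ → Hp × Hq),
          IsHNGeodesicOn N.toFun (inHoro wp ap wq aq) α Set.univ →
          IsHpType wq aq κ α ∨ IsHqType wp ap κ α := by
  have hδ0 : 0 ≤ δ := zero_le_one.trans hδ
  by_cases hN : N.toFun (0, 1) ≤ 1 ∨ 1 < N.toFun (1, 0)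
  · obtain ⟨κ, hκ, h⟩ := exists_type_bound δ hδ0 N hN
    exact ⟨κ, hκ, fun Hp Hq _ _ _ _ hp hq bp bq cp cq wp ap rp wq aq rq α hα =>
      h Hp Hq wp ap wq aq ⟨hδ0, hp, bp, cp, rp⟩ ⟨hδ0, hq, bq, cq, rq⟩ α hα⟩
  · rw [not_or, not_le, not_lt] at hN
    obtain ⟨κ, hκ, h⟩ := exists_type_bound δ hδ0 N.swap (Or.inl hN.2)
    exact ⟨κ, hκ, fun Hp Hq _ _ _ _ hp hq bp bq cp cq wp ap rp wq aq rq α hα =>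
      (h Hq Hp wq aq wp ap ⟨hδ0, hq, bq, cq, rq⟩ ⟨hδ0, hp, bp, cp, rp⟩ _ hα.swap).symm⟩

end HP

end
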